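/- arXiv:2208.00058 — 8 statements merged into one kernel-verified Lean document; each statement's English description precedes it below -/
import Mathlib

section
/- Let Ω ⊂ ℝ² be a bounded open set. There exists a constant C > 0 depending only on Ω such that for every κ > 0 and every Lipschitz map m : ℝ² → ℝ³ with |m(x)| = 1 for all x and m = −e₃ on ℝ² \ Ω, one has E_κ(m) ≥ (1 − Cκ) ∫_Ω |∇m|² dx. -/
open MeasureTheory Real

noncomputable section

/-- The constant map `e₃ = (0,0,1)`. -/
def e3 : Fin 3 → ℝ := ![0, 0, 1]

/-- Partial derivative in the first coordinate direction. -/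
def pd1 (m : ℝ × ℝ → Fin 3 → ℝ) (x : ℝ × ℝ) : Fin 3 → ℝ := fderiv ℝ m x (1, 0)

/-- Partial derivative in the second coordinate direction. -/
def pd2 (m : ℝ × ℝ → Fin 3 → ℝ) (x : ℝ × ℝ) : Fin 3 → ℝ := fderiv ℝ m x (0, 1)

/-- Squared Frobenius norm of the gradient, `|∇m|² = Σ_{i,j} (∂_i m_j)²`. -/
def gradSq (m : ℝ × ℝ → Fin 3 → ℝ) (x : ℝ × ℝ) : ℝ :=
  (∑ j, (pd1 m x j) ^ 2) + (∑ j, (pd2 m x j) ^ 2)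

/-- The DMI density `m'·∇m₃ = m₁ ∂₁m₃ + m₂ ∂₂m₃`. -/
def dmiDens (m : ℝ × ℝ → Fin 3 → ℝ) (x : ℝ × ℝ) : ℝ :=
  m x 0 * pd1 m x 2 + m x 1 * pd2 m x 2

/-- The energy `E_κ(m) = ∫_Ω (|∇m|² − 2κ m'·∇m₃) dx`. -/
def energy (κ : ℝ) (Ω : Set (ℝ × ℝ)) (m : ℝ × ℝ → Fin 3 → ℝ) : ℝ :=
  ∫ x in Ω, (gradSq m x - 2 * κ * dmiDens m x)

theorem elb_pd_bound {m : ℝ × ℝ → Fin 3 → ℝ} {K : NNReal} (hK : LipschitzWith K m) (x v : ℝ × ℝ)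
    (hv : ‖v‖ ≤ 1) (j : Fin 3) : |fderiv ℝ m x v j| ≤ K := by
  have h1 : ‖fderiv ℝ m x v j‖ ≤ ‖fderiv ℝ m x v‖ := norm_le_pi_norm _ j
  have h2 := (fderiv ℝ m x).le_opNorm v
  have h3 : ‖fderiv ℝ m x‖ ≤ K := norm_fderiv_le_of_lipschitz ℝ hK
  have h4 : ‖fderiv ℝ m x‖ * ‖v‖ ≤ K * 1 := by gcongr
  rw [Real.norm_eq_abs] at h1
  linarith

theorem elb_meas (m : ℝ × ℝ → Fin 3 → ℝ) (v : ℝ × ℝ) (j : Fin 3) :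
    Measurable (fun x => fderiv ℝ m x v j) :=
  (measurable_pi_apply j).comp (measurable_fderiv_apply_const ℝ m v)

theorem elb_sq {a K : ℝ} (h : |a| ≤ K) : a ^ 2 ≤ K ^ 2 := by
  rw [← sq_abs]; gcongr

theorem elb_gradSq_int {Ω : Set (ℝ × ℝ)} (hfin : volume Ω < ⊤)
    {m : ℝ × ℝ → Fin 3 → ℝ} {K : NNReal} (hK : LipschitzWith K m) :
    IntegrableOn (gradSq m) Ω := by
  refine Measure.integrableOn_of_bounded (M := 6 * (K:ℝ) ^ 2) hfin.ne ?_ ?_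
  · have : Measurable (gradSq m) := by
      unfold gradSq pd1 pd2
      exact (Finset.measurable_sum _ fun j _ => (elb_meas m (1,0) j).pow_const 2).add
        (Finset.measurable_sum _ fun j _ => (elb_meas m (0,1) j).pow_const 2)
    exact this.aestronglyMeasurable
  · refine Filter.Eventually.of_forall fun x => ?_
    have a (j) := elb_sq (elb_pd_bound hK x (1,0) (by simp [Prod.norm_def]) j)
    have b (j) := elb_sq (elb_pd_bound hK x (0,1) (by simp [Prod.norm_def]) j)
    have h0 : 0 ≤ gradSq m x := by unfold gradSq; positivity
    rw [Real.norm_eq_abs, abs_of_nonneg h0]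
    simp only [gradSq, pd1, pd2, Fin.sum_univ_three]
    linarith [a 0, a 1, a 2, b 0, b 1, b 2]

theorem elb_le_one {m : ℝ × ℝ → Fin 3 → ℝ} (hm : ∀ x, (∑ i, (m x i) ^ 2) = 1) (x) (i : Fin 3) :
    |m x i| ≤ 1 := by
  have h := hm x
  rw [← sq_le_one_iff_abs_le_one, ← h]
  exact Finset.single_le_sum (f := fun i => (m x i) ^ 2) (fun i _ => sq_nonneg _) (Finset.mem_univ i)

theorem elb_poincare {Ω : Set (ℝ × ℝ)} (hΩo : IsOpen Ω) (hΩb : Bornology.IsBounded Ω)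
    {R : ℝ} (hR : ∀ x ∈ Ω, |x.1| ≤ R)
    {m : ℝ × ℝ → Fin 3 → ℝ} {K : NNReal} (hK : LipschitzWith K m)
    (hm : ∀ x, (∑ i, (m x i) ^ 2) = 1) (hb : ∀ x ∉ Ω, m x = -e3) :
    ∫ x in Ω, ((m x 0) ^ 2 + (m x 1) ^ 2) ≤ 4 * R ^ 2 * ∫ x in Ω, gradSq m x := by
  have hfin : volume Ω < ⊤ := hΩb.measure_lt_top
  set g : ℝ × ℝ → ℝ := fun x => (m x 0) ^ 2 + (m x 1) ^ 2 with hg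
  have hz0 : ∀ x ∉ Ω, m x 0 = 0 := fun x hx => by simp [hb x hx, e3]
  have hz1 : ∀ x ∉ Ω, m x 1 = 0 := fun x hx => by simp [hb x hx, e3]
  have hg0 : ∀ x ∉ Ω, g x = 0 := fun x hx => by simp [hg, hz0 x hx, hz1 x hx]
  have hgs : HasCompactSupport g :=
    HasCompactSupport.intro hΩb.isCompact_closure fun x hx => hg0 x fun h => hx (subset_closure h)
  have hcomp : ∀ i x y, |m x i - m y i| ≤ K * dist x y := fun i x y =>
    (dist_le_pi_dist (m x) (m y) i).trans (hK.dist_le_mul x y)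
  have hsq : ∀ i x y, |(m x i) ^ 2 - (m y i) ^ 2| ≤ 2 * (K * dist x y) := fun i x y => by
    have : (m x i) ^ 2 - (m y i) ^ 2 = (m x i + m y i) * (m x i - m y i) := by ring
    rw [this, abs_mul]
    have h2 : |m x i + m y i| ≤ 2 := by
      linarith [abs_add_le (m x i) (m y i), elb_le_one hm x i, elb_le_one hm y i]
    exact mul_le_mul h2 (hcomp i x y) (abs_nonneg _) (by norm_num)
  have hgl : LipschitzWith (4 * K) g := by
    refine LipschitzWith.of_dist_le_mul fun x y => ?_
    rw [Real.dist_eq]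
    have : g x - g y = ((m x 0) ^ 2 - (m y 0) ^ 2) + ((m x 1) ^ 2 - (m y 1) ^ 2) := by
      simp only [hg]; ring
    rw [this]
    push_cast
    linarith [abs_add_le ((m x 0) ^ 2 - (m y 0) ^ 2) ((m x 1) ^ 2 - (m y 1) ^ 2), hsq 0 x y, hsq 1 x y]
  have hgi : Integrable g := hgl.continuous.integrable_of_hasCompactSupport hgs
  have hGi := elb_gradSq_int hfin hK
  have hibp := LipschitzWith.integral_lineDeriv_mul_eq (μ := volume)
    (LipschitzWith.prod_fst (α := ℝ) (β := ℝ)) hgl hgs ((1, 0) : ℝ × ℝ)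
  have hl1 : ∀ x : ℝ × ℝ, lineDeriv ℝ (Prod.fst : ℝ × ℝ → ℝ) x (1, 0) = 1 := fun x => by
    rw [differentiableAt_fst.lineDeriv_eq_fderiv, fderiv_fst]; simp
  simp only [hl1, one_mul] at hibp
  have hpt : ∀ᵐ x : ℝ × ℝ, lineDeriv ℝ g x (-(1, 0)) * x.1 ≤
      g x / 2 + 2 * R ^ 2 * Ω.indicator (gradSq m) x := by
    filter_upwards [hK.ae_differentiableAt] with x hx
    have hc : ∀ i, HasFDerivAt (fun y => m y i)
        ((ContinuousLinearMap.proj i).comp (fderiv ℝ m x)) x := fun i =>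
      hasFDerivAt_pi'.1 hx.hasFDerivAt i
    have hd := ((hc 0).pow 2).add ((hc 1).pow 2)
    have hl : lineDeriv ℝ g x (-(1, 0)) = -(2 * (m x 0 * pd1 m x 0 + m x 1 * pd1 m x 1)) := by
      have h1 := (hd.hasLineDerivAt (-(1, 0))).lineDeriv
      refine Eq.trans h1 ?_
      rw [map_neg]
      simp [pd1]
      ring
    rw [hl]
    by_cases hxΩ : x ∈ Ω
    · rw [Set.indicator_of_mem hxΩ]
      have hr : x.1 ^ 2 ≤ R ^ 2 := elb_sq (hR x hxΩ)
      have hG : (pd1 m x 0) ^ 2 + (pd1 m x 1) ^ 2 ≤ gradSq m x := by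
        simp only [gradSq, Fin.sum_univ_three]
        nlinarith [sq_nonneg (pd1 m x 2), sq_nonneg (pd2 m x 0), sq_nonneg (pd2 m x 1), sq_nonneg (pd2 m x 2)]
      have h1 : x.1 ^ 2 * ((pd1 m x 0) ^ 2 + (pd1 m x 1) ^ 2) ≤ R ^ 2 * gradSq m x := by gcongr
      simp only [hg]
      nlinarith [sq_nonneg (m x 0 + 2 * x.1 * pd1 m x 0), sq_nonneg (m x 1 + 2 * x.1 * pd1 m x 1)]
    · rw [Set.indicator_of_notMem hxΩ]
      simp [hg, hz0 x hxΩ, hz1 x hxΩ]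
  have hri : Integrable (fun x => g x / 2 + 2 * R ^ 2 * Ω.indicator (gradSq m) x) :=
    (hgi.div_const 2).add ((hGi.integrable_indicator hΩo.measurableSet).const_mul _)
  have hgn : 0 ≤ ∫ x, g x := integral_nonneg fun x => by simp only [hg]; positivity
  have hGn : 0 ≤ ∫ x in Ω, gradSq m x := integral_nonneg fun x => by
    simp only [gradSq, Pi.zero_apply]; positivity
  have hset : ∫ x in Ω, g x = ∫ x, g x := setIntegral_eq_integral_of_forall_compl_eq_zero hg0
  rw [hset]
  by_cases hli : Integrable (fun x : ℝ × ℝ => lineDeriv ℝ g x (-(1, 0)) * x.1)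
  · have h := integral_mono_ae hli hri hpt
    rw [← hibp, integral_add (hgi.div_const 2)
      ((hGi.integrable_indicator hΩo.measurableSet).const_mul _), integral_div,
      integral_const_mul, integral_indicator hΩo.measurableSet] at h
    linarith
  · rw [integral_undef hli] at hibp
    rw [hibp]; positivity

/-- for a bounded open `Ω ⊂ ℝ²` there is `C > 0` (depending only on `Ω`)
such that for all `κ > 0` and all Lipschitz sphere-valued `m` equal to `−e₃` off `Ω`,
`E_κ(m) ≥ (1 − Cκ) ∫_Ω |∇m|² dx`. -/
theorem energy_lower_bound (Ω : Set (ℝ × ℝ)) (hΩo : IsOpen Ω)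
    (hΩb : Bornology.IsBounded Ω) :
    ∃ C > (0 : ℝ), ∀ κ > (0 : ℝ), ∀ m : ℝ × ℝ → Fin 3 → ℝ,
      (∃ K, LipschitzWith K m) →
      (∀ x, (∑ i, (m x i) ^ 2) = 1) →
      (∀ x ∉ Ω, m x = -e3) →
      (1 - C * κ) * (∫ x in Ω, gradSq m x) ≤ energy κ Ω m := by
  obtain ⟨R, hR⟩ := hΩb.exists_norm_le
  refine ⟨4 * R ^ 2 + 1, by positivity, fun κ hκ m ⟨K, hK⟩ hm hb => ?_⟩
  have hfin : volume Ω < ⊤ := hΩb.measure_lt_top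
  have hP := elb_poincare hΩo hΩb (R := R)
    (fun x hx => (norm_fst_le x).trans (hR x hx)) hK hm hb
  have hGi := elb_gradSq_int hfin hK
  have hmi : ∀ i, Continuous fun x => m x i := fun i => (continuous_apply i).comp hK.continuous
  have hgi : IntegrableOn (fun x => (m x 0) ^ 2 + (m x 1) ^ 2) Ω :=
    ((((hmi 0).pow 2).add ((hmi 1).pow 2)).continuousOn.integrableOn_compact
      hΩb.isCompact_closure).mono_set subset_closure
  have hDi : IntegrableOn (dmiDens m) Ω := by
    refine Measure.integrableOn_of_bounded (M := 2 * (K:ℝ)) hfin.ne ?_ ?_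
    · have : Measurable (dmiDens m) :=
        ((hmi 0).measurable.mul (elb_meas m (1,0) 2)).add
          ((hmi 1).measurable.mul (elb_meas m (0,1) 2))
      exact this.aestronglyMeasurable
    · refine Filter.Eventually.of_forall fun x => ?_
      have a := elb_pd_bound hK x (1,0) (by simp [Prod.norm_def]) 2
      have b := elb_pd_bound hK x (0,1) (by simp [Prod.norm_def]) 2
      have h1 := mul_le_mul (elb_le_one hm x 0) a (abs_nonneg _) zero_le_one
      have h2 := mul_le_mul (elb_le_one hm x 1) b (abs_nonneg _) zero_le_one
      rw [← abs_mul] at h1 h2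
      rw [Real.norm_eq_abs]
      refine (abs_add_le _ _).trans ?_
      simp only [pd1, pd2]
      linarith
  have hD : ∫ x in Ω, 2 * dmiDens m x ≤
      ∫ x in Ω, (((m x 0) ^ 2 + (m x 1) ^ 2) + gradSq m x) := by
    refine integral_mono (hDi.const_mul 2) (hgi.add hGi) fun x => ?_
    simp only [gradSq, dmiDens, Fin.sum_univ_three]
    nlinarith [sq_nonneg (m x 0 - pd1 m x 2), sq_nonneg (m x 1 - pd2 m x 2),
      sq_nonneg (pd1 m x 0), sq_nonneg (pd1 m x 1), sq_nonneg (pd2 m x 0), sq_nonneg (pd2 m x 1)]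
  rw [integral_add hgi hGi, integral_const_mul] at hD
  have hE : energy κ Ω m = (∫ x in Ω, gradSq m x) - 2 * κ * ∫ x in Ω, dmiDens m x := by
    unfold energy
    rw [integral_sub hGi (hDi.const_mul _), integral_const_mul]
  rw [hE]
  nlinarith [mul_le_mul_of_nonneg_left (hD.trans (add_le_add_left hP _)) hκ.le]

end
end

section
/- Let Ω ⊂ ℝ² be a bounded open set. There exists a constant C > 0 depending only on Ω such that for every κ with 0 < κ < 1/(2C) and every Lipschitz map m : ℝ² → ℝ³ with |m(x)| = 1 for all x, m = −e₃ on ℝ² \ Ω, and E_κ(m) < 8π, one has ∫_Ω |∇m|² dx − 8π ≤ 16πCκ. -/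
open MeasureTheory Real

noncomputable section

lemma aux_pointwise (m : ℝ × ℝ → Fin 3 → ℝ) (x : ℝ × ℝ) (hd : DifferentiableAt ℝ m x) :
    lineDeriv ℝ (fun y => m y 0 ^ 2 + m y 1 ^ 2) x (1, 0)
      = 2 * (m x 0 * pd1 m x 0 + m x 1 * pd1 m x 1) := by
  have h1 : HasLineDerivAt ℝ m (fderiv ℝ m x (1, 0)) x (1, 0) :=
    hd.hasFDerivAt.hasLineDerivAt _
  have h2 := hasDerivAt_pi.1 h1
  have h3 := ((h2 0).pow 2).add ((h2 1).pow 2)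
  have h4 : HasLineDerivAt ℝ (fun y => m y 0 ^ 2 + m y 1 ^ 2)
      (2 * (m x 0 * pd1 m x 0 + m x 1 * pd1 m x 1)) x (1, 0) := by
    unfold HasLineDerivAt
    convert h3 using 1
    · rfl
    · simp [pd1]
      ring
  exact h4.lineDeriv

lemma aux_coord_le (m : ℝ × ℝ → Fin 3 → ℝ) (h : ∀ x, (∑ i, (m x i) ^ 2) = 1) (x : ℝ × ℝ)
    (i : Fin 3) : |m x i| ≤ 1 := by
  rw [← sq_le_one_iff_abs_le_one, ← h x]
  exact Finset.single_le_sum (f := fun i => (m x i) ^ 2) (fun j _ => sq_nonneg _)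
    (Finset.mem_univ i)

lemma aux_lip (m : ℝ × ℝ → Fin 3 → ℝ) (K : NNReal) (hK : LipschitzWith K m)
    (h : ∀ x, (∑ i, (m x i) ^ 2) = 1) :
    LipschitzWith (4 * K) (fun y => m y 0 ^ 2 + m y 1 ^ 2) := by
  apply LipschitzWith.of_dist_le_mul
  intro x y
  have key : ∀ i, |m x i ^ 2 - m y i ^ 2| ≤ 2 * (K * dist x y) := by
    intro i
    have h1 : |m x i - m y i| ≤ K * dist x y := by
      rw [← Real.dist_eq]
      exact (dist_le_pi_dist (m x) (m y) i).trans (hK.dist_le_mul x y)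
    have h2 : |m x i + m y i| ≤ 2 := by
      have := abs_add_le (m x i) (m y i)
      have := aux_coord_le m h x i
      have := aux_coord_le m h y i
      linarith
    rw [sq_sub_sq, abs_mul]
    exact mul_le_mul h2 h1 (abs_nonneg _) (by norm_num)
  rw [Real.dist_eq]
  have e : m x 0 ^ 2 + m x 1 ^ 2 - (m y 0 ^ 2 + m y 1 ^ 2)
    = (m x 0 ^ 2 - m y 0 ^ 2) + (m x 1 ^ 2 - m y 1 ^ 2) := by ring
  rw [e]
  have := abs_add_le (m x 0 ^ 2 - m y 0 ^ 2) (m x 1 ^ 2 - m y 1 ^ 2)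
  have := key 0
  have := key 1
  push_cast
  linarith

lemma aux_pd_bound (m : ℝ × ℝ → Fin 3 → ℝ) (K : NNReal) (hK : LipschitzWith K m)
    (x v : ℝ × ℝ) (hv : ‖v‖ ≤ 1) (i : Fin 3) : |fderiv ℝ m x v i| ≤ K := by
  rw [← Real.norm_eq_abs]
  calc ‖fderiv ℝ m x v i‖ ≤ ‖fderiv ℝ m x v‖ := norm_le_pi_norm _ i
    _ ≤ ‖fderiv ℝ m x‖ * ‖v‖ := ContinuousLinearMap.le_opNorm _ _
    _ ≤ K * 1 := mul_le_mul (norm_fderiv_le_of_lipschitz ℝ hK) hv (norm_nonneg _) K.2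
    _ = K := mul_one _

lemma aux_integrable (Ω : Set (ℝ × ℝ)) (hΩb : Bornology.IsBounded Ω)
    (f : ℝ × ℝ → ℝ) (hf : Measurable f) (B : ℝ)
    (hB : ∀ x, |f x| ≤ B) : IntegrableOn f Ω :=
  Measure.integrableOn_of_bounded hΩb.measure_lt_top.ne hf.aestronglyMeasurable
    (M := B) (Filter.Eventually.of_forall hB)

lemma aux_ibp (Ω : Set (ℝ × ℝ)) (hΩb : Bornology.IsBounded Ω)
    (m : ℝ × ℝ → Fin 3 → ℝ) (K : NNReal) (hK : LipschitzWith K m)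
    (h : ∀ x, (∑ i, (m x i) ^ 2) = 1) (hm : ∀ x ∉ Ω, m x = -e3) :
    ∫ x in Ω, (m x 0 ^ 2 + m x 1 ^ 2)
      = ∫ x in Ω, -(2 * (m x 0 * pd1 m x 0 + m x 1 * pd1 m x 1)) * x.1 := by
  have hz : ∀ x ∉ Ω, m x 0 = 0 ∧ m x 1 = 0 := by
    intro x hx
    rw [hm x hx]
    simp [e3]
  have hsupp : HasCompactSupport (fun y => m y 0 ^ 2 + m y 1 ^ 2) := by
    apply HasCompactSupport.intro hΩb.isCompact_closure
    intro x hx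
    obtain ⟨a, b⟩ := hz x (fun hx' => hx (subset_closure hx'))
    simp [a, b]
  have hfst : LipschitzWith 1 (fun x : ℝ × ℝ => x.1) := LipschitzWith.prod_fst
  have hI := LipschitzWith.integral_lineDeriv_mul_eq (μ := (volume : Measure (ℝ × ℝ)))
    hfst (aux_lip m K hK h) hsupp (1, 0)
  have hl : ∀ x : ℝ × ℝ, lineDeriv ℝ (fun x : ℝ × ℝ => x.1) x (1, 0) = 1 := by
    intro x
    have : HasFDerivAt (fun x : ℝ × ℝ => x.1) (ContinuousLinearMap.fst ℝ ℝ ℝ) x := hasFDerivAt_fst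
    simpa using (this.hasLineDerivAt (1, 0)).lineDeriv
  simp only [hl, one_mul] at hI
  rw [setIntegral_eq_integral_of_forall_compl_eq_zero, hI,
    setIntegral_eq_integral_of_forall_compl_eq_zero]
  · apply integral_congr_ae
    filter_upwards [hK.ae_differentiableAt (μ := (volume : Measure (ℝ × ℝ)))] with x hx
    rw [lineDeriv_neg, aux_pointwise m x hx]
  · intro x hx
    simp [hz x hx]
  · intro x hx
    simp [hz x hx]

/-- for a bounded open `Ω ⊂ ℝ²` there is `C > 0` (depending only on `Ω`)
such that for all `0 < κ < 1/(2C)` and all Lipschitz sphere-valued `m` equal to `−e₃`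
off `Ω` with `E_κ(m) < 8π`, the Dirichlet excess satisfies
`∫_Ω |∇m|² dx − 8π ≤ 16πCκ`. -/
theorem dirichlet_excess_bound (Ω : Set (ℝ × ℝ)) (hΩo : IsOpen Ω)
    (hΩb : Bornology.IsBounded Ω) :
    ∃ C > (0 : ℝ), ∀ κ : ℝ, 0 < κ → κ < 1 / (2 * C) →
      ∀ m : ℝ × ℝ → Fin 3 → ℝ,
      (∃ K, LipschitzWith K m) →
      (∀ x, (∑ i, (m x i) ^ 2) = 1) →
      (∀ x ∉ Ω, m x = -e3) →
      energy κ Ω m < 8 * π →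
      (∫ x in Ω, gradSq m x) - 8 * π ≤ 16 * π * C * κ := by
  obtain ⟨R, hR, hRΩ⟩ := hΩb.exists_pos_norm_le
  refine ⟨2 * R, by positivity, ?_⟩
  rintro κ hκ hκC m ⟨K, hK⟩ hone hm hE
  have hmeas1 : ∀ i, Measurable (fun x => pd1 m x i) := fun i =>
    (measurable_pi_apply i).comp (measurable_fderiv_apply_const ℝ m (1, 0))
  have hmeas2 : ∀ i, Measurable (fun x => pd2 m x i) := fun i =>
    (measurable_pi_apply i).comp (measurable_fderiv_apply_const ℝ m (0, 1))
  have hmm : ∀ i, Measurable (fun x => m x i) := fun i =>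
    ((continuous_apply i).comp hK.continuous).measurable
  have b1 : ∀ x i, |pd1 m x i| ≤ K := fun x i =>
    aux_pd_bound m K hK x (1, 0) (by simp [Prod.norm_def]) i
  have b2 : ∀ x i, |pd2 m x i| ≤ K := fun x i =>
    aux_pd_bound m K hK x (0, 1) (by simp [Prod.norm_def]) i
  have bm := aux_coord_le m hone
  have sq1 : ∀ x i, |pd1 m x i ^ 2| ≤ (K : ℝ) ^ 2 := fun x i => by
    rw [abs_pow]; exact pow_le_pow_left₀ (abs_nonneg _) (b1 x i) 2
  have sq2 : ∀ x i, |pd2 m x i ^ 2| ≤ (K : ℝ) ^ 2 := fun x i => by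
    rw [abs_pow]; exact pow_le_pow_left₀ (abs_nonneg _) (b2 x i) 2
  have i1 : ∀ i, IntegrableOn (fun x => pd1 m x i ^ 2) Ω := fun i =>
    aux_integrable Ω hΩb _ ((hmeas1 i).pow_const 2) _ (fun x => sq1 x i)
  have i2 : ∀ i, IntegrableOn (fun x => pd2 m x i ^ 2) Ω := fun i =>
    aux_integrable Ω hΩb _ ((hmeas2 i).pow_const 2) _ (fun x => sq2 x i)
  have bprod : ∀ a b : ℝ, |a| ≤ 1 → |b| ≤ K → |a * b| ≤ K := by
    intro a b ha hb
    rw [abs_mul]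
    nlinarith [abs_nonneg a, abs_nonneg b]
  have ip1 : ∀ i j, IntegrableOn (fun x => m x i * pd1 m x j) Ω := fun i j =>
    aux_integrable Ω hΩb _ ((hmm i).mul (hmeas1 j)) _ (fun x => bprod _ _ (bm x i) (b1 x j))
  have ip2 : ∀ i j, IntegrableOn (fun x => m x i * pd2 m x j) Ω := fun i j =>
    aux_integrable Ω hΩb _ ((hmm i).mul (hmeas2 j)) _ (fun x => bprod _ _ (bm x i) (b2 x j))
  have im : ∀ i, IntegrableOn (fun x => m x i ^ 2) Ω := fun i =>
    aux_integrable Ω hΩb _ ((hmm i).pow_const 2) 1 (fun x => by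
      rw [abs_pow]; exact pow_le_one₀ (abs_nonneg _) (bm x i))
  have ih : IntegrableOn (fun x => m x 0 ^ 2 + m x 1 ^ 2) Ω := (im 0).add (im 1)
  have iP : IntegrableOn (fun x => pd1 m x 0 ^ 2 + pd1 m x 1 ^ 2) Ω := (i1 0).add (i1 1)
  have iQ : IntegrableOn (fun x => pd1 m x 2 ^ 2 + pd2 m x 2 ^ 2) Ω := (i1 2).add (i2 2)
  have ig : IntegrableOn (fun x => gradSq m x) Ω := by
    unfold gradSq
    exact (integrable_finsetSum _ fun i _ => i1 i).add (integrable_finsetSum _ fun i _ => i2 i)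
  have id : IntegrableOn (fun x => dmiDens m x) Ω := (ip1 0 2).add (ip2 1 2)
  -- Poincare
  have hP : ∫ x in Ω, (m x 0 ^ 2 + m x 1 ^ 2) ≤
      ∫ x in Ω, ((1 / 2) * (m x 0 ^ 2 + m x 1 ^ 2)
        + 2 * R ^ 2 * (pd1 m x 0 ^ 2 + pd1 m x 1 ^ 2)) := by
    rw [aux_ibp Ω hΩb m K hK hone hm]
    by_cases hint : IntegrableOn
      (fun x => -(2 * (m x 0 * pd1 m x 0 + m x 1 * pd1 m x 1)) * x.1) Ω
    · refine setIntegral_mono_on hint ((ih.const_mul _).add (iP.const_mul _))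
        hΩo.measurableSet ?_
      intro x hx
      have hx1 : |x.1| ≤ R := by
        have := hRΩ x hx
        exact (norm_fst_le x).trans this
      have hx2 : x.1 ^ 2 ≤ R ^ 2 := sq_le_sq' (by linarith [neg_abs_le x.1]) (by linarith [le_abs_self x.1])
      have := mul_le_mul_of_nonneg_right hx2
        (by positivity : 0 ≤ pd1 m x 0 ^ 2 + pd1 m x 1 ^ 2)
      nlinarith [sq_nonneg (m x 0 + 2 * x.1 * pd1 m x 0),
        sq_nonneg (m x 1 + 2 * x.1 * pd1 m x 1)]
    · rw [integral_undef hint]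
      exact integral_nonneg fun x => by positivity
  rw [integral_add (ih.const_mul _) (iP.const_mul _), integral_const_mul, integral_const_mul] at hP
  -- DMI bound
  have hD : ∫ x in Ω, dmiDens m x ≤ ∫ x in Ω, ((1 / (4 * R)) * (m x 0 ^ 2 + m x 1 ^ 2)
        + R * (pd1 m x 2 ^ 2 + pd2 m x 2 ^ 2)) := by
    refine integral_mono id ((ih.const_mul _).add (iQ.const_mul _)) ?_
    intro x
    have e : (1 / (4 * R)) * (m x 0 ^ 2 + m x 1 ^ 2)
        + R * (pd1 m x 2 ^ 2 + pd2 m x 2 ^ 2) - dmiDens m x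
        = (1 / (4 * R)) * ((m x 0 - 2 * R * pd1 m x 2) ^ 2
          + (m x 1 - 2 * R * pd2 m x 2) ^ 2) := by
      unfold dmiDens
      field_simp
      ring
    have : 0 ≤ (1 / (4 * R)) * ((m x 0 - 2 * R * pd1 m x 2) ^ 2
          + (m x 1 - 2 * R * pd2 m x 2) ^ 2) := by positivity
    show dmiDens m x ≤ _
    linarith
  rw [integral_add (ih.const_mul _) (iQ.const_mul _), integral_const_mul, integral_const_mul] at hD
  have hG : (∫ x in Ω, (pd1 m x 0 ^ 2 + pd1 m x 1 ^ 2))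
      + (∫ x in Ω, (pd1 m x 2 ^ 2 + pd2 m x 2 ^ 2)) ≤ ∫ x in Ω, gradSq m x := by
    rw [← integral_add iP iQ]
    refine integral_mono (iP.add iQ) ig ?_
    intro x
    simp only [gradSq, Fin.sum_univ_three]
    nlinarith [sq_nonneg (pd2 m x 0), sq_nonneg (pd2 m x 1)]
  have hE' : (∫ x in Ω, gradSq m x) - 2 * κ * ∫ x in Ω, dmiDens m x < 8 * π := by
    unfold energy at hE
    rwa [integral_sub ig (id.const_mul _), integral_const_mul] at hE
  set G := ∫ x in Ω, gradSq m x
  set H := ∫ x in Ω, (m x 0 ^ 2 + m x 1 ^ 2)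
  set P := ∫ x in Ω, (pd1 m x 0 ^ 2 + pd1 m x 1 ^ 2)
  set Q := ∫ x in Ω, (pd1 m x 2 ^ 2 + pd2 m x 2 ^ 2)
  set D := ∫ x in Ω, dmiDens m x
  have hH : 1 / (4 * R) * H ≤ R * P := by
    have : H ≤ 4 * R ^ 2 * P := by linarith
    calc 1 / (4 * R) * H ≤ 1 / (4 * R) * (4 * R ^ 2 * P) := by gcongr
      _ = R * P := by field_simp
  have hDG : D ≤ R * G := by nlinarith
  have hc : κ * (2 * R) < 1 / 2 := by
    rw [lt_div_iff₀ (by positivity)] at hκC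
    linarith
  have hc0 : 0 < κ * (2 * R) := by positivity
  set c := κ * (2 * R) with hcdef
  have h1 : (1 - c) * G < 8 * π := by
    have := mul_le_mul_of_nonneg_left hDG hκ.le
    rw [hcdef]
    nlinarith
  have h2 : 8 * π ≤ (1 - c) * (8 * π * (1 + 2 * c)) := by
    have : 0 ≤ 8 * π * (c * (1 - 2 * c)) := by
      have : 0 ≤ 1 - 2 * c := by linarith
      positivity
    nlinarith
  have h3 : G < 8 * π * (1 + 2 * c) :=
    lt_of_mul_lt_mul_left (h1.trans_le h2) (by linarith)
  have : 16 * π * (2 * R) * κ = 16 * π * c := by rw [hcdef]; ring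
  linarith

end
end

section
/- Let Ω ⊂ ℝ² be a nonempty bounded open set. For every κ > 0 there exists a Lipschitz map m : ℝ² → ℝ³ with |m(x)| = 1 for all x, m = −e₃ on ℝ² \ Ω, topological degree N(m) = 1, and E_κ(m) < 8π. -/
open MeasureTheory Real

noncomputable section

/-- Cross product in `ℝ³`. -/
def cross3 (u v : Fin 3 → ℝ) : Fin 3 → ℝ :=
  ![u 1 * v 2 - u 2 * v 1, u 2 * v 0 - u 0 * v 2, u 0 * v 1 - u 1 * v 0]

/-- The topological degree `N(m) = (1/4π) ∫_{ℝ²} m · (∂₁m × ∂₂m) dx`. -/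
def degree (m : ℝ × ℝ → Fin 3 → ℝ) : ℝ :=
  (1 / (4 * π)) * ∫ x : ℝ × ℝ, ∑ i, m x i * cross3 (pd1 m x) (pd2 m x) i


/-! ### Auxiliary radial profiles, as functions of `u = r²` -/

/-- Cut-off factor. -/
def qf (R u : ℝ) : ℝ := max (1 - u / R ^ 2) 0

/-- The profile `σ`. -/
def sf (ρ R u : ℝ) : ℝ := ρ * (qf R u) ^ 2

/-- The derivative factor `τ`, with `∂_i σ = x_i τ`. -/
def tf (ρ R u : ℝ) : ℝ := -(4 * ρ / R ^ 2) * qf R u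

/-- The denominator. -/
def Sf (ρ R u : ℝ) : ℝ := u + (sf ρ R u) ^ 2

/-- squared radius -/
def rsq (p : ℝ × ℝ) : ℝ := p.1 ^ 2 + p.2 ^ 2

/-- The competitor centred at the origin. -/
def Mf (ρ R : ℝ) (p : ℝ × ℝ) : Fin 3 → ℝ :=
  ![-(2 * sf ρ R (rsq p) * p.1) / Sf ρ R (rsq p),
    -(2 * sf ρ R (rsq p) * p.2) / Sf ρ R (rsq p),
    ((sf ρ R (rsq p)) ^ 2 - rsq p) / Sf ρ R (rsq p)]

/-- degree density -/
def Df (ρ R u : ℝ) : ℝ :=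
  4 * sf ρ R u * (sf ρ R u - tf ρ R u * u) / (Sf ρ R u) ^ 2

/-- excess density -/
def Ef (ρ R u : ℝ) : ℝ := 4 * (tf ρ R u) ^ 2 * u ^ 2 / (Sf ρ R u) ^ 2

/-- DMI density -/
def Wf (ρ R u : ℝ) : ℝ :=
  8 * (sf ρ R u) ^ 2 * u * (sf ρ R u - tf ρ R u * u) / (Sf ρ R u) ^ 3

lemma rsq_nonneg (p : ℝ × ℝ) : 0 ≤ rsq p := by unfold rsq; positivity

lemma qf_nonneg (R u : ℝ) : 0 ≤ qf R u := le_max_right _ _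

lemma qf_le_one (R u : ℝ) (hu : 0 ≤ u) : qf R u ≤ 1 := by
  unfold qf
  have : 0 ≤ u / R ^ 2 := by positivity
  exact max_le (by linarith) zero_le_one

lemma qf_zero (R : ℝ) : qf R 0 = 1 := by simp [qf]

lemma qf_eq_zero {R u : ℝ} (hR : 0 < R) (hu : R ^ 2 ≤ u) : qf R u = 0 := by
  unfold qf
  apply max_eq_right
  have : 1 ≤ u / R ^ 2 := by rw [le_div_iff₀ (by positivity)]; linarith
  linarith

lemma Sf_pos {ρ R u : ℝ} (hρ : 0 < ρ) (hu : 0 ≤ u) : 0 < Sf ρ R u := by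
  unfold Sf
  rcases hu.eq_or_lt with h | h
  · subst h
    simp only [sf, qf_zero]
    positivity
  · positivity

lemma hd_congr {f g : ℝ → ℝ} {f' g' x : ℝ} (h : HasDerivAt f f' x)
    (hfg : ∀ z, g z = f z) (h' : g' = f') : HasDerivAt g g' x := by
  have : g = f := funext hfg
  rw [this, h']; exact h

lemma hasDerivAt_maxsq (y : ℝ) :
    HasDerivAt (fun z : ℝ => (max z 0) ^ 2) (2 * max y 0) y := by
  have h0 : (fun z : ℝ => (max z 0) ^ 2 - (max y 0) ^ 2 - 2 * max y 0 * (z - y))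
      =O[nhds y] fun z => ‖z - y‖ ^ 2 := by
    apply Asymptotics.IsBigO.of_bound 1
    filter_upwards with z
    simp only [Real.norm_eq_abs, sq_abs, one_mul, abs_pow]
    rw [abs_le]
    rcases le_total z 0 with hz | hz <;> rcases le_total y 0 with hy | hy <;>
      simp only [max_eq_left, max_eq_right, hz, hy] <;> constructor <;>
      nlinarith [sq_nonneg z, sq_nonneg y, sq_nonneg (z - y)]
  have h1 := (h0.hasFDerivAt (by norm_num)).hasDerivAt
  have h2 : HasDerivAt (fun z : ℝ => (max y 0) ^ 2 + 2 * max y 0 * (z - y)) (2 * max y 0) y := by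
    simpa using (((hasDerivAt_id y).sub_const y).const_mul (2 * max y 0)).const_add ((max y 0) ^ 2)
  have h3 := h1.add h2
  refine hd_congr h3 (fun z => ?_) ?_
  · simp only [Pi.add_apply]; ring
  · simp

lemma hasDerivAt_sf (ρ R u : ℝ) :
    HasDerivAt (sf ρ R) (tf ρ R u / 2) u := by
  have h1 : HasDerivAt (fun v : ℝ => 1 - v / R ^ 2) (-(1 / R ^ 2)) u := by
    simpa using ((hasDerivAt_id u).div_const (R ^ 2)).const_sub 1
  have h2 := ((hasDerivAt_maxsq (1 - u / R ^ 2)).comp u h1).const_mul ρ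
  refine hd_congr h2 (fun z => rfl) ?_
  simp only [tf, qf]
  ring

lemma continuous_qf (R : ℝ) : Continuous (qf R) := by unfold qf; fun_prop
lemma continuous_sf (ρ R : ℝ) : Continuous (sf ρ R) := by
  unfold sf; have := continuous_qf R; fun_prop
lemma continuous_tf (ρ R : ℝ) : Continuous (tf ρ R) := by
  unfold tf; have := continuous_qf R; fun_prop
lemma continuous_Sf (ρ R : ℝ) : Continuous (Sf ρ R) := by
  unfold Sf; have := continuous_sf ρ R; fun_prop
lemma continuous_rsq : Continuous rsq := by unfold rsq; fun_prop

lemma contDiff_sf (ρ R : ℝ) : ContDiff ℝ 1 (sf ρ R) := by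
  rw [contDiff_one_iff_deriv]
  refine ⟨fun u => (hasDerivAt_sf ρ R u).differentiableAt, ?_⟩
  have : deriv (sf ρ R) = fun u => tf ρ R u / 2 := funext fun u => (hasDerivAt_sf ρ R u).deriv
  rw [this]
  exact (continuous_tf ρ R).div_const 2

lemma contDiff_rsq : ContDiff ℝ 1 rsq := by unfold rsq; fun_prop

lemma contDiff_Mf {ρ : ℝ} (R : ℝ) (hρ : 0 < ρ) : ContDiff ℝ 1 (Mf ρ R) := by
  have hs : ContDiff ℝ 1 (fun p => sf ρ R (rsq p)) := (contDiff_sf ρ R).comp contDiff_rsq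
  have hr := contDiff_rsq
  have hS : ContDiff ℝ 1 (fun p => Sf ρ R (rsq p)) := by unfold Sf; fun_prop
  have hne : ∀ p, Sf ρ R (rsq p) ≠ 0 := fun p => (Sf_pos hρ (rsq_nonneg p)).ne'
  rw [contDiff_pi]
  intro i
  fin_cases i
  · exact ContDiff.div (by fun_prop) hS hne
  · exact ContDiff.div (by fun_prop) hS hne
  · exact ContDiff.div (by fun_prop) hS hne

lemma cont_D {ρ : ℝ} (R : ℝ) (hρ : 0 < ρ) : Continuous (fun p => Df ρ R (rsq p)) := by
  have h1 := (continuous_sf ρ R).comp continuous_rsq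
  have h2 := (continuous_tf ρ R).comp continuous_rsq
  have h3 := (continuous_Sf ρ R).comp continuous_rsq
  have h4 := continuous_rsq
  simp only [Function.comp_def] at h1 h2 h3
  unfold Df
  exact Continuous.div (by fun_prop) (by fun_prop)
    fun p => (pow_pos (Sf_pos hρ (rsq_nonneg p)) _).ne'

lemma cont_E {ρ : ℝ} (R : ℝ) (hρ : 0 < ρ) : Continuous (fun p => Ef ρ R (rsq p)) := by
  have h1 := (continuous_sf ρ R).comp continuous_rsq
  have h2 := (continuous_tf ρ R).comp continuous_rsq
  have h3 := (continuous_Sf ρ R).comp continuous_rsq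
  have h4 := continuous_rsq
  simp only [Function.comp_def] at h1 h2 h3
  unfold Ef
  exact Continuous.div (by fun_prop) (by fun_prop)
    fun p => (pow_pos (Sf_pos hρ (rsq_nonneg p)) _).ne'

lemma cont_W {ρ : ℝ} (R : ℝ) (hρ : 0 < ρ) : Continuous (fun p => Wf ρ R (rsq p)) := by
  have h1 := (continuous_sf ρ R).comp continuous_rsq
  have h2 := (continuous_tf ρ R).comp continuous_rsq
  have h3 := (continuous_Sf ρ R).comp continuous_rsq
  have h4 := continuous_rsq
  simp only [Function.comp_def] at h1 h2 h3
  unfold Wf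
  exact Continuous.div (by fun_prop) (by fun_prop)
    fun p => (pow_pos (Sf_pos hρ (rsq_nonneg p)) _).ne'

lemma rsq_ge_of_not_mem {R : ℝ} (hR : 0 < R) {p : ℝ × ℝ}
    (hp : p ∉ Metric.closedBall (0 : ℝ × ℝ) R) : R ^ 2 ≤ rsq p := by
  simp only [Metric.mem_closedBall, dist_zero_right, Prod.norm_def, sup_le_iff,
    Real.norm_eq_abs, not_and_or, not_le] at hp
  unfold rsq
  rcases hp with h | h
  · nlinarith [sq_abs p.1, sq_nonneg p.2]
  · nlinarith [sq_abs p.2, sq_nonneg p.1]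

lemma Df_zero {ρ R u : ℝ} (hR : 0 < R) (hu : R ^ 2 ≤ u) : Df ρ R u = 0 := by
  simp [Df, sf, qf_eq_zero hR hu]
lemma Ef_zero {ρ R u : ℝ} (hR : 0 < R) (hu : R ^ 2 ≤ u) : Ef ρ R u = 0 := by
  simp [Ef, tf, qf_eq_zero hR hu]
lemma Wf_zero {ρ R u : ℝ} (hR : 0 < R) (hu : R ^ 2 ≤ u) : Wf ρ R u = 0 := by
  simp [Wf, sf, qf_eq_zero hR hu]

lemma Mf_out {ρ R : ℝ} (hR : 0 < R) {p : ℝ × ℝ} (hp : R ^ 2 ≤ rsq p) : Mf ρ R p = -e3 := by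
  have h0 : rsq p ≠ 0 := by nlinarith [pow_pos hR 2]
  ext i
  fin_cases i <;> simp [Mf, e3, Sf, sf, qf_eq_zero hR hp]
  field_simp

lemma integrable_of_cont {R : ℝ} (hR : 0 < R) {g : ℝ → ℝ} (hc : Continuous fun p => g (rsq p))
    (h0 : ∀ u, R ^ 2 ≤ u → g u = 0) : Integrable (fun p : ℝ × ℝ => g (rsq p)) :=
  hc.integrable_of_hasCompactSupport
    (HasCompactSupport.intro (isCompact_closedBall (0 : ℝ × ℝ) R)
      fun _ hp => h0 _ (rsq_ge_of_not_mem hR hp))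

lemma lipschitz_Mf {ρ R : ℝ} (hρ : 0 < ρ) (hR : 0 < R) : ∃ K, LipschitzWith K (Mf ρ R) := by
  have hc : ContDiff ℝ 1 (fun p => Mf ρ R p + e3) := (contDiff_Mf R hρ).add contDiff_const
  have hs : HasCompactSupport (fun p => Mf ρ R p + e3) :=
    HasCompactSupport.intro (isCompact_closedBall (0 : ℝ × ℝ) R)
      fun p hp => by rw [Mf_out hR (rsq_ge_of_not_mem hR hp)]; simp
  obtain ⟨K, hK⟩ := hc.lipschitzWith_of_hasCompactSupport hs (by norm_num)
  refine ⟨K, fun p q => ?_⟩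
  simpa using hK p q

lemma norm_Mf {ρ R : ℝ} (hρ : 0 < ρ) (p : ℝ × ℝ) : (∑ i, (Mf ρ R p i) ^ 2) = 1 := by
  have h := Sf_pos (R := R) hρ (rsq_nonneg p)
  have hS : Sf ρ R (rsq p) = p.1 ^ 2 + p.2 ^ 2 + (sf ρ R (rsq p)) ^ 2 := by simp [Sf, rsq]
  have hr : rsq p = p.1 ^ 2 + p.2 ^ 2 := rfl
  simp only [Fin.sum_univ_three, Mf, Matrix.cons_val_zero, Matrix.cons_val_one, Matrix.cons_val]
  generalize sf ρ R (rsq p) = s at *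
  generalize Sf ρ R (rsq p) = S at *
  rw [hr]
  field_simp
  rw [hS]
  ring

/-- Partial derivatives along a curve. -/
lemma hasDeriv_curve {ρ R : ℝ} (hρ : 0 < ρ) {a b : ℝ → ℝ} {a' b' t : ℝ}
    (ha : HasDerivAt a a' t) (hb : HasDerivAt b b' t) (s τ S : ℝ)
    (hs : s = sf ρ R (rsq (a t, b t))) (hτ : τ = tf ρ R (rsq (a t, b t)))
    (hS : S = Sf ρ R (rsq (a t, b t))) :
    fderiv ℝ (Mf ρ R) (a t, b t) (a', b') =
     ![-(2 * (τ * (a t * a' + b t * b')) * a t + 2 * s * a') / S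
          + 2 * s * a t * (2 * (a t * a' + b t * b') * (1 + s * τ)) / S ^ 2,
       -(2 * (τ * (a t * a' + b t * b')) * b t + 2 * s * b') / S
          + 2 * s * b t * (2 * (a t * a' + b t * b') * (1 + s * τ)) / S ^ 2,
       (2 * (a t * a' + b t * b') * (s * τ - 1)) / S
          - (s ^ 2 - (a t ^ 2 + b t ^ 2)) * (2 * (a t * a' + b t * b') * (1 + s * τ)) / S ^ 2] := by
  have hd : DifferentiableAt ℝ (Mf ρ R) (a t, b t) :=
    (contDiff_Mf R hρ).differentiable (by norm_num) _
  have hS0 : Sf ρ R (rsq (a t, b t)) ≠ 0 := (Sf_pos hρ (rsq_nonneg _)).ne'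
  have h1 : HasDerivAt (fun z => Mf ρ R (a z, b z)) (fderiv ℝ (Mf ρ R) (a t, b t) (a', b')) t :=
    HasFDerivAt.comp_hasDerivAt (l := Mf ρ R) t hd.hasFDerivAt (ha.prodMk hb)
  have hr : HasDerivAt (fun z => rsq (a z, b z)) (2 * (a t * a' + b t * b')) t := by
    have := (ha.pow 2).add (hb.pow 2)
    refine hd_congr this (fun z => rfl) ?_
    simp; ring
  have hsd : HasDerivAt (fun z => sf ρ R (rsq (a z, b z))) (τ * (a t * a' + b t * b')) t := by
    have := (hasDerivAt_sf ρ R (rsq (a t, b t))).comp t hr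
    refine hd_congr this (fun z => rfl) ?_
    rw [hτ]; ring
  have hSd : HasDerivAt (fun z => Sf ρ R (rsq (a z, b z)))
      (2 * (a t * a' + b t * b') * (1 + s * τ)) t := by
    have := hr.add (hsd.pow 2)
    refine hd_congr this (fun z => rfl) ?_
    rw [← hs]; simp; ring
  refine h1.unique ?_
  rw [hasDerivAt_pi]
  intro i
  fin_cases i
  · have := ((hsd.const_mul 2).mul ha).neg.div hSd hS0
    refine hd_congr this (fun z => rfl) ?_
    simp only [← hs, ← hS, Pi.neg_apply, Pi.mul_apply]
    rw [← hS] at hS0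
    simp
    field_simp
  · have := ((hsd.const_mul 2).mul hb).neg.div hSd hS0
    refine hd_congr this (fun z => rfl) ?_
    simp only [← hs, ← hS, Pi.neg_apply, Pi.mul_apply]
    rw [← hS] at hS0
    simp
    field_simp
  · have := ((hsd.pow 2).sub hr).div hSd hS0
    refine hd_congr this (fun z => rfl) ?_
    simp [← hs, ← hS]
    rw [← hS] at hS0
    have : rsq (a t, b t) = a t ^ 2 + b t ^ 2 := rfl
    rw [this]
    field_simp

lemma pd1_Mf {ρ R : ℝ} (hρ : 0 < ρ) (p : ℝ × ℝ) (s τ S : ℝ)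
    (hs : s = sf ρ R (rsq p)) (hτ : τ = tf ρ R (rsq p)) (hS : S = Sf ρ R (rsq p)) :
    pd1 (Mf ρ R) p =
     ![-(2 * (τ * p.1) * p.1 + 2 * s) / S + 2 * s * p.1 * (2 * p.1 * (1 + s * τ)) / S ^ 2,
       -(2 * (τ * p.1) * p.2) / S + 2 * s * p.2 * (2 * p.1 * (1 + s * τ)) / S ^ 2,
       (2 * p.1 * (s * τ - 1)) / S
          - (s ^ 2 - (p.1 ^ 2 + p.2 ^ 2)) * (2 * p.1 * (1 + s * τ)) / S ^ 2] := by
  have := hasDeriv_curve (R := R) hρ (hasDerivAt_id p.1) (hasDerivAt_const p.1 p.2) s τ S hs hτ hS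
  simpa [pd1] using this

lemma pd2_Mf {ρ R : ℝ} (hρ : 0 < ρ) (p : ℝ × ℝ) (s τ S : ℝ)
    (hs : s = sf ρ R (rsq p)) (hτ : τ = tf ρ R (rsq p)) (hS : S = Sf ρ R (rsq p)) :
    pd2 (Mf ρ R) p =
     ![-(2 * (τ * p.2) * p.1) / S + 2 * s * p.1 * (2 * p.2 * (1 + s * τ)) / S ^ 2,
       -(2 * (τ * p.2) * p.2 + 2 * s) / S + 2 * s * p.2 * (2 * p.2 * (1 + s * τ)) / S ^ 2,
       (2 * p.2 * (s * τ - 1)) / S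
          - (s ^ 2 - (p.1 ^ 2 + p.2 ^ 2)) * (2 * p.2 * (1 + s * τ)) / S ^ 2] := by
  have := hasDeriv_curve (R := R) hρ (hasDerivAt_const p.2 p.1) (hasDerivAt_id p.2) s τ S hs hτ hS
  simpa [pd2] using this

lemma dens_D {ρ R : ℝ} (hρ : 0 < ρ) (p : ℝ × ℝ) :
    ∑ i, Mf ρ R p i * cross3 (pd1 (Mf ρ R) p) (pd2 (Mf ρ R) p) i = Df ρ R (rsq p) := by
  have h := (Sf_pos (R := R) hρ (rsq_nonneg p)).ne'
  have hS : Sf ρ R (rsq p) = p.1 ^ 2 + p.2 ^ 2 + (sf ρ R (rsq p)) ^ 2 := by simp [Sf, rsq]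
  have hr : rsq p = p.1 ^ 2 + p.2 ^ 2 := rfl
  rw [pd1_Mf hρ p _ _ _ rfl rfl rfl, pd2_Mf hρ p _ _ _ rfl rfl rfl]
  simp only [Fin.sum_univ_three, Mf, Df, cross3, Matrix.cons_val_zero, Matrix.cons_val_one,
    Matrix.cons_val]
  generalize sf ρ R (rsq p) = s at *
  generalize tf ρ R (rsq p) = τ at *
  generalize Sf ρ R (rsq p) = S at *
  rw [hr]
  field_simp
  rw [hS]
  ring

lemma dens_G {ρ R : ℝ} (hρ : 0 < ρ) (p : ℝ × ℝ) :
    gradSq (Mf ρ R) p = 2 * Df ρ R (rsq p) + Ef ρ R (rsq p) := by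
  have h := (Sf_pos (R := R) hρ (rsq_nonneg p)).ne'
  have hS : Sf ρ R (rsq p) = p.1 ^ 2 + p.2 ^ 2 + (sf ρ R (rsq p)) ^ 2 := by simp [Sf, rsq]
  have hr : rsq p = p.1 ^ 2 + p.2 ^ 2 := rfl
  unfold gradSq
  rw [pd1_Mf hρ p _ _ _ rfl rfl rfl, pd2_Mf hρ p _ _ _ rfl rfl rfl]
  simp only [Fin.sum_univ_three, Df, Ef, Matrix.cons_val_zero, Matrix.cons_val_one,
    Matrix.cons_val]
  generalize sf ρ R (rsq p) = s at *
  generalize tf ρ R (rsq p) = τ at *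
  generalize Sf ρ R (rsq p) = S at *
  rw [hr]
  field_simp
  rw [hS]
  ring

lemma dens_W {ρ R : ℝ} (hρ : 0 < ρ) (p : ℝ × ℝ) :
    dmiDens (Mf ρ R) p = Wf ρ R (rsq p) := by
  have h := (Sf_pos (R := R) hρ (rsq_nonneg p)).ne'
  have hS : Sf ρ R (rsq p) = p.1 ^ 2 + p.2 ^ 2 + (sf ρ R (rsq p)) ^ 2 := by simp [Sf, rsq]
  have hr : rsq p = p.1 ^ 2 + p.2 ^ 2 := rfl
  unfold dmiDens
  rw [pd1_Mf hρ p _ _ _ rfl rfl rfl, pd2_Mf hρ p _ _ _ rfl rfl rfl]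
  simp only [Mf, Wf, Matrix.cons_val_zero, Matrix.cons_val_one, Matrix.cons_val]
  generalize sf ρ R (rsq p) = s at *
  generalize tf ρ R (rsq p) = τ at *
  generalize Sf ρ R (rsq p) = S at *
  rw [hr]
  field_simp
  rw [hS]
  ring

lemma tf_nonpos {ρ R u : ℝ} (hρ : 0 < ρ) : tf ρ R u ≤ 0 := by
  have := qf_nonneg R u
  unfold tf
  have : 0 ≤ 4 * ρ / R ^ 2 * qf R u := by positivity
  linarith

lemma sf_nonneg {ρ R u : ℝ} (hρ : 0 < ρ) : 0 ≤ sf ρ R u := by unfold sf; positivity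

lemma Df_nonneg {ρ R u : ℝ} (hρ : 0 < ρ) (hu : 0 ≤ u) : 0 ≤ Df ρ R u := by
  have h1 := tf_nonpos (R := R) (u := u) hρ
  have h2 := sf_nonneg (R := R) (u := u) hρ
  have h3 : 0 ≤ sf ρ R u - tf ρ R u * u := by nlinarith
  unfold Df; positivity

lemma Wf_nonneg {ρ R u : ℝ} (hρ : 0 < ρ) (hu : 0 ≤ u) : 0 ≤ Wf ρ R u := by
  have h1 := tf_nonpos (R := R) (u := u) hρ
  have h2 := sf_nonneg (R := R) (u := u) hρ
  have h3 : 0 ≤ sf ρ R u - tf ρ R u * u := by nlinarith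
  have := (Sf_pos (R := R) hρ hu).le
  unfold Wf; positivity

lemma Ef_le {ρ R u : ℝ} (hρ : 0 < ρ) (hR : 0 < R) (hu : 0 ≤ u) :
    Ef ρ R u ≤ 64 * ρ ^ 2 / R ^ 4 := by
  have hS := Sf_pos (R := R) hρ hu
  have h1 : u ^ 2 ≤ (Sf ρ R u) ^ 2 := by
    apply pow_le_pow_left₀ hu
    unfold Sf; nlinarith [sq_nonneg (sf ρ R u)]
  have h2 : (tf ρ R u) ^ 2 ≤ 16 * ρ ^ 2 / R ^ 4 := by
    have e : (tf ρ R u) ^ 2 = 16 * ρ ^ 2 / R ^ 4 * (qf R u) ^ 2 := by unfold tf; field_simp; ring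
    rw [e]
    apply mul_le_of_le_one_right (by positivity)
    exact pow_le_one₀ (qf_nonneg R u) (qf_le_one R u hu)
  unfold Ef
  rw [div_le_iff₀ (by positivity)]
  calc 4 * (tf ρ R u) ^ 2 * u ^ 2 ≤ 4 * (16 * ρ ^ 2 / R ^ 4) * (Sf ρ R u) ^ 2 := by gcongr
    _ = _ := by ring

lemma Wf_ge {ρ R u : ℝ} (hρ : 0 < ρ) (hR : 0 < R) (hρR : ρ ≤ R / 3)
    (h1 : ρ ^ 2 / 4 ≤ u) (h2 : u ≤ 5 * ρ ^ 2 / 4) : 16 / 729 / ρ ≤ Wf ρ R u := by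
  have hu : 0 ≤ u := le_trans (by positivity) h1
  have hS := Sf_pos (R := R) hρ hu
  have ht := tf_nonpos (R := R) (u := u) hρ
  have hq1 := qf_le_one R u hu
  have hq : 3 / 4 ≤ qf R u := by
    have : u / R ^ 2 ≤ 1 / 4 := by
      rw [div_le_iff₀ (by positivity)]; nlinarith
    exact le_trans (by linarith) (le_max_left _ _)
  have hs : ρ / 2 ≤ sf ρ R u := by unfold sf; nlinarith [mul_le_mul hq hq (by norm_num) (by linarith)]
  have hs1 : sf ρ R u ≤ ρ := by
    unfold sf
    exact mul_le_of_le_one_right hρ.le (pow_le_one₀ (qf_nonneg R u) hq1)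
  have hSle : Sf ρ R u ≤ 9 * ρ ^ 2 / 4 := by unfold Sf; nlinarith
  have h3 : ρ / 2 ≤ sf ρ R u - tf ρ R u * u := by nlinarith
  have hs0 : 0 ≤ sf ρ R u := le_trans (by positivity) hs
  unfold Wf
  calc 16 / 729 / ρ = 8 * (ρ / 2) ^ 2 * (ρ ^ 2 / 4) * (ρ / 2) / (9 * ρ ^ 2 / 4) ^ 3 := by
        field_simp; norm_num
    _ ≤ _ := by
        have h4 : 0 ≤ sf ρ R u - tf ρ R u * u := le_trans (by positivity) h3
        have h5 : 0 ≤ 8 * sf ρ R u ^ 2 * u * (sf ρ R u - tf ρ R u * u) := by positivity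
        gcongr

lemma hasDerivAt_b {ρ R : ℝ} (hρ : 0 < ρ) (r : ℝ) :
    HasDerivAt (fun z : ℝ => -(((sf ρ R (z ^ 2)) ^ 2 - z ^ 2) / Sf ρ R (z ^ 2)))
      (r * Df ρ R (r ^ 2)) r := by
  have hS0 : Sf ρ R (r ^ 2) ≠ 0 := (Sf_pos hρ (sq_nonneg r)).ne'
  have hr : HasDerivAt (fun z : ℝ => z ^ 2) (2 * r) r := by simpa using hasDerivAt_pow 2 r
  have hsd : HasDerivAt (fun z => sf ρ R (z ^ 2)) (tf ρ R (r ^ 2) * r) r := by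
    have := (hasDerivAt_sf ρ R (r ^ 2)).comp r hr
    refine hd_congr this (fun z => rfl) ?_
    ring
  have hSd := hr.add (hsd.pow 2)
  have := (((hsd.pow 2).sub hr).div hSd hS0).neg
  refine hd_congr this (fun z => rfl) ?_
  have e : Sf ρ R (r ^ 2) = r ^ 2 + (sf ρ R (r ^ 2)) ^ 2 := rfl
  simp [Df]
  rw [e] at hS0 ⊢
  field_simp
  ring

lemma radial_D {ρ R : ℝ} (hρ : 0 < ρ) (hR : 0 < R) :
    ∫ r in Set.Ioi (0 : ℝ), r * Df ρ R (r ^ 2) = 2 := by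
  have h := integral_Ioi_of_hasDerivAt_of_nonneg (a := 0) (l := 1)
    (hasDerivAt_b (R := R) hρ 0).continuousAt.continuousWithinAt
    (fun r _ => hasDerivAt_b (R := R) hρ r)
    (fun r hr => mul_nonneg (le_of_lt hr) (Df_nonneg hρ (sq_nonneg r))) ?_
  · rw [h]
    have e : sf ρ R 0 = ρ := by simp [sf, qf_zero]
    simp [Sf, e]
    field_simp
    norm_num
  · apply tendsto_const_nhds.congr'
    filter_upwards [Filter.eventually_ge_atTop R] with r hr
    have h1 : R ^ 2 ≤ r ^ 2 := by gcongr
    have : r ≠ 0 := (lt_of_lt_of_le hR hr).ne'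
    simp [Sf, sf, qf_eq_zero hR h1]
    field_simp

lemma integral_D {ρ R : ℝ} (hρ : 0 < ρ) (hR : 0 < R) :
    ∫ p : ℝ × ℝ, Df ρ R (rsq p) = 4 * π := by
  rw [← integral_comp_polarCoord_symm]
  have e : ∀ p : ℝ × ℝ, p.1 • Df ρ R (rsq (polarCoord.symm p))
      = (p.1 * Df ρ R (p.1 ^ 2)) * (fun _ : ℝ => (1 : ℝ)) p.2 := by
    intro p
    have : rsq (polarCoord.symm p) = p.1 ^ 2 := by
      simp only [rsq, polarCoord_symm_apply]
      nlinarith [Real.sin_sq_add_cos_sq p.2]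
    rw [this]; simp
  simp_rw [e]
  rw [polarCoord_target, Measure.volume_eq_prod, setIntegral_prod_mul (fun r : ℝ => r * Df ρ R (r ^ 2)) (fun _ : ℝ => (1:ℝ)), radial_D hρ hR]
  simp
  rw [max_eq_left (by positivity)]
  ring

lemma integral_E {ρ R : ℝ} (hρ : 0 < ρ) (hR : 0 < R) :
    ∫ p : ℝ × ℝ, Ef ρ R (rsq p) ≤ 256 * ρ ^ 2 / R ^ 2 := by
  have hz : ∀ p ∉ Set.Icc (-R) R ×ˢ Set.Icc (-R) R, Ef ρ R (rsq p) = 0 := by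
    intro p hp
    apply Ef_zero hR (rsq_ge_of_not_mem hR _)
    intro h
    apply hp
    simp only [Metric.mem_closedBall, dist_zero_right, Prod.norm_def, sup_le_iff,
      Real.norm_eq_abs, abs_le] at h
    exact ⟨h.1, h.2⟩
  have hv : volume.real (Set.Icc (-R) R ×ˢ Set.Icc (-R) R) = 4 * R ^ 2 := by
    rw [Measure.volume_eq_prod, measureReal_prod_prod]
    simp
    rw [max_eq_left (by linarith)]
    ring
  have hfin : volume (Set.Icc (-R) R ×ˢ Set.Icc (-R) R) ≠ ⊤ :=
    (isCompact_Icc.prod isCompact_Icc).measure_lt_top.ne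
  rw [← setIntegral_eq_integral_of_forall_compl_eq_zero hz]
  calc _ ≤ ∫ p in Set.Icc (-R) R ×ˢ Set.Icc (-R) R, 64 * ρ ^ 2 / R ^ 4 := by
        apply setIntegral_mono
        · exact (integrable_of_cont hR (cont_E R hρ) fun u => Ef_zero hR).integrableOn
        · exact integrableOn_const hfin
        · intro p
          exact Ef_le hρ hR (rsq_nonneg p)
    _ = _ := by
        rw [setIntegral_const, hv, smul_eq_mul]
        field_simp
        norm_num

lemma integral_W {ρ R : ℝ} (hρ : 0 < ρ) (hR : 0 < R) (hρR : ρ ≤ R / 3) :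
    4 / 729 * ρ ≤ ∫ p : ℝ × ℝ, Wf ρ R (rsq p) := by
  have hint := integrable_of_cont hR (cont_W R hρ) fun u => Wf_zero hR
  have hv : volume.real (Set.Icc (ρ / 2) ρ ×ˢ Set.Icc 0 (ρ / 2)) = ρ ^ 2 / 4 := by
    rw [Measure.volume_eq_prod, measureReal_prod_prod]
    simp
    rw [max_eq_left (by linarith), max_eq_left (by linarith)]
    ring
  have hfin : volume (Set.Icc (ρ / 2) ρ ×ˢ Set.Icc 0 (ρ / 2)) ≠ ⊤ :=
    (isCompact_Icc.prod isCompact_Icc).measure_lt_top.ne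
  calc 4 / 729 * ρ = ∫ p in Set.Icc (ρ / 2) ρ ×ˢ Set.Icc 0 (ρ / 2), 16 / 729 / ρ := by
        rw [setIntegral_const, hv, smul_eq_mul]
        field_simp
        norm_num
    _ ≤ ∫ p in Set.Icc (ρ / 2) ρ ×ˢ Set.Icc 0 (ρ / 2), Wf ρ R (rsq p) := by
        apply setIntegral_mono_on
        · exact integrableOn_const hfin
        · exact hint.integrableOn
        · exact measurableSet_Icc.prod measurableSet_Icc
        · rintro p ⟨⟨h1, h2⟩, h3, h4⟩
          apply Wf_ge hρ hR hρR <;> unfold rsq <;> nlinarith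
    _ ≤ _ := setIntegral_le_integral hint
        (Filter.Eventually.of_forall fun p => Wf_nonneg hρ (rsq_nonneg p))

/-- for a nonempty bounded open `Ω ⊂ ℝ²` and every `κ > 0` there is a
Lipschitz sphere-valued map `m`, equal to `−e₃` off `Ω`, of degree `1`, with
`E_κ(m) < 8π`. -/
theorem exists_competitor_below_8pi (Ω : Set (ℝ × ℝ)) (hΩo : IsOpen Ω)
    (hΩb : Bornology.IsBounded Ω) (hΩne : Ω.Nonempty) :
    ∀ κ > (0 : ℝ), ∃ m : ℝ × ℝ → Fin 3 → ℝ,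
      (∃ K, LipschitzWith K m) ∧
      (∀ x, (∑ i, (m x i) ^ 2) = 1) ∧
      (∀ x ∉ Ω, m x = -e3) ∧
      degree m = 1 ∧
      energy κ Ω m < 8 * π := by
  intro κ hκ
  obtain ⟨c, hc⟩ := hΩne
  obtain ⟨R, hR, hball⟩ := Metric.nhds_basis_closedBall.mem_iff.1 (hΩo.mem_nhds hc)
  set ρ : ℝ := min (R / 3) (κ * R ^ 2 / 30000) with hρdef
  have hρ : 0 < ρ := lt_min (by positivity) (by positivity)
  have hρ1 : ρ ≤ R / 3 := min_le_left _ _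
  have hρ2 : ρ ≤ κ * R ^ 2 / 30000 := min_le_right _ _
  have hout : ∀ x ∉ Ω, R ^ 2 ≤ rsq (x - c) := by
    intro x hx
    apply rsq_ge_of_not_mem hR
    intro h
    apply hx
    apply hball
    simpa [dist_eq_norm] using h
  have hp1 : ∀ x, pd1 (fun x => Mf ρ R (x - c)) x = pd1 (Mf ρ R) (x - c) := by
    intro x; unfold pd1; rw [fderiv_comp_sub]
  have hp2 : ∀ x, pd2 (fun x => Mf ρ R (x - c)) x = pd2 (Mf ρ R) (x - c) := by
    intro x; unfold pd2; rw [fderiv_comp_sub]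
  refine ⟨fun x => Mf ρ R (x - c), ?_, fun x => norm_Mf hρ _,
    fun x hx => Mf_out hR (hout x hx), ?_, ?_⟩
  · obtain ⟨K, hK⟩ := lipschitz_Mf hρ hR
    refine ⟨K, fun x y => ?_⟩
    simpa using hK (x - c) (y - c)
  · unfold degree
    simp_rw [hp1, hp2, dens_D hρ]
    rw [integral_sub_right_eq_self (fun x => Df ρ R (rsq x)) c, integral_D hρ hR]
    have := Real.pi_pos
    field_simp
  · have hg : ∀ x, gradSq (fun x => Mf ρ R (x - c)) x
        = 2 * Df ρ R (rsq (x - c)) + Ef ρ R (rsq (x - c)) := by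
      intro x
      rw [← dens_G hρ]
      unfold gradSq
      rw [hp1, hp2]
    have hw : ∀ x, dmiDens (fun x => Mf ρ R (x - c)) x = Wf ρ R (rsq (x - c)) := by
      intro x
      rw [← dens_W hρ]
      unfold dmiDens
      rw [hp1, hp2]
    unfold energy
    simp_rw [hg, hw]
    rw [setIntegral_eq_integral_of_forall_compl_eq_zero (fun x hx => by
      rw [Df_zero hR (hout x hx), Ef_zero hR (hout x hx), Wf_zero hR (hout x hx)]; ring),
      integral_sub_right_eq_self
        (fun x => 2 * Df ρ R (rsq x) + Ef ρ R (rsq x) - 2 * κ * Wf ρ R (rsq x)) c]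
    have iD := integrable_of_cont hR (cont_D R hρ) fun u => Df_zero hR
    have iE := integrable_of_cont hR (cont_E R hρ) fun u => Ef_zero hR
    have iW := integrable_of_cont hR (cont_W R hρ) fun u => Wf_zero hR
    have iDE : Integrable (fun p : ℝ × ℝ => 2 * Df ρ R (rsq p) + Ef ρ R (rsq p)) :=
      (iD.const_mul 2).add iE
    rw [integral_sub iDE (iW.const_mul (2 * κ)),
      integral_add (iD.const_mul 2) iE, integral_const_mul, integral_const_mul, integral_D hρ hR]
    have hE := integral_E hρ hR
    have hW := integral_W hρ hR hρ1
    have h1 : 256 * ρ ^ 2 / R ^ 2 ≤ 256 / 30000 * κ * ρ := by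
      rw [div_le_iff₀ (by positivity)]
      nlinarith
    have h2 : 2 * κ * (4 / 729 * ρ) ≤ 2 * κ * ∫ p : ℝ × ℝ, Wf ρ R (rsq p) := by gcongr
    have h3 : 0 < κ * ρ := by positivity
    nlinarith

end
end

section
/- Let Ω ⊂ ℝ² be a nonempty bounded open set. There exist constants C > 0 and κ₀ > 0 depending only on Ω such that for every κ ∈ (0, κ₀) there exists a Lipschitz map m : ℝ² → ℝ³ with |m(x)| = 1 for all x, m = −e₃ on ℝ² \ Ω, topological degree N(m) = 1, and E_κ(m) ≤ 8π − Cκ². -/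
open MeasureTheory Real

noncomputable section

/-- squared distance to the centre -/
def qq (a b : ℝ) (x : ℝ × ℝ) : ℝ := (x.1 - a) ^ 2 + (x.2 - b) ^ 2

/-- denominator -/
def DD (a b R l : ℝ) (x : ℝ × ℝ) : ℝ := l ^ 2 * (R ^ 2 - qq a b x) ^ 2 + qq a b x

/-- smooth model map -/
def GG (a b R l : ℝ) (p : (ℝ × ℝ) × ℝ) : Fin 3 → ℝ :=
  ![-2 * l * p.2 * (p.1.1 - a) / DD a b R l p.1, -2 * l * p.2 * (p.1.2 - b) / DD a b R l p.1,
    -1 + 2 * l ^ 2 * p.2 ^ 2 / DD a b R l p.1]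

/-- the competitor -/
def MM (a b R l : ℝ) (x : ℝ × ℝ) : Fin 3 → ℝ := GG a b R l (x, max (R ^ 2 - qq a b x) 0)

/-- the competitor inside -/
def FF (a b R l : ℝ) (x : ℝ × ℝ) : Fin 3 → ℝ := GG a b R l (x, R ^ 2 - qq a b x)

lemma qq_nonneg (a b : ℝ) (x : ℝ × ℝ) : 0 ≤ qq a b x := by unfold qq; positivity

lemma DD_pos {a b R l : ℝ} (hR : 0 < R) (hl : 0 < l) (x : ℝ × ℝ) : 0 < DD a b R l x := by
  unfold DD
  have h := qq_nonneg a b x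
  rcases h.eq_or_lt with h | h
  · rw [← h, show l ^ 2 * (R ^ 2 - 0) ^ 2 + 0 = (l * R ^ 2) ^ 2 by ring]; positivity
  · positivity

lemma qq_contDiff (a b : ℝ) : ContDiff ℝ 1 (qq a b) := by unfold qq; fun_prop

lemma DD_contDiff (a b R l : ℝ) : ContDiff ℝ 1 (DD a b R l) := by
  have := qq_contDiff a b
  unfold DD; fun_prop

lemma GG_contDiff {a b R l : ℝ} (hR : 0 < R) (hl : 0 < l) : ContDiff ℝ 1 (GG a b R l) := by
  have h : ContDiff ℝ 1 (fun p : (ℝ × ℝ) × ℝ => DD a b R l p.1) :=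
    (DD_contDiff a b R l).comp contDiff_fst
  have h0 : ∀ p : (ℝ × ℝ) × ℝ, DD a b R l p.1 ≠ 0 := fun p => (DD_pos hR hl p.1).ne'
  rw [contDiff_pi]
  intro i
  fin_cases i
  · exact ContDiff.div (by fun_prop) h h0
  · exact ContDiff.div (by fun_prop) h h0
  · exact contDiff_const.add (ContDiff.div (by fun_prop) h h0)

lemma FF_contDiff {a b R l : ℝ} (hR : 0 < R) (hl : 0 < l) : ContDiff ℝ 1 (FF a b R l) := by
  have := qq_contDiff a b
  exact (GG_contDiff hR hl).comp (contDiff_id.prodMk (contDiff_const.sub this))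

lemma MM_locLip {a b R l : ℝ} (hR : 0 < R) (hl : 0 < l) : LocallyLipschitz (MM a b R l) := by
  have := qq_contDiff a b
  have h1 : LocallyLipschitz (fun x => R ^ 2 - qq a b x) :=
    (contDiff_const.sub this).locallyLipschitz
  exact (GG_contDiff hR hl).locallyLipschitz.comp (LocallyLipschitz.id.prodMk (h1.max_const 0))

lemma MM_out {a b R l : ℝ} {x : ℝ × ℝ} (h : R ^ 2 ≤ qq a b x) : MM a b R l x = -e3 := by
  have : max (R ^ 2 - qq a b x) 0 = 0 := max_eq_right (by linarith)
  ext i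
  fin_cases i <;> simp [MM, GG, this, e3]

lemma MM_in {a b R l : ℝ} {x : ℝ × ℝ} (h : qq a b x ≤ R ^ 2) : MM a b R l x = FF a b R l x := by
  have : max (R ^ 2 - qq a b x) 0 = R ^ 2 - qq a b x := max_eq_left (by linarith)
  simp [MM, FF, this]

lemma MM_unit {a b R l : ℝ} (hR : 0 < R) (hl : 0 < l) (x : ℝ × ℝ) :
    ∑ i, (MM a b R l x i) ^ 2 = 1 := by
  rcases le_total (R ^ 2) (qq a b x) with h | h
  · rw [MM_out h]; simp [Fin.sum_univ_three, e3]
  · rw [MM_in h]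
    have hD := (DD_pos (a := a) (b := b) hR hl x).ne'
    simp only [FF, GG, Fin.sum_univ_three, Matrix.cons_val_zero, Matrix.cons_val_one,
      Matrix.cons_val]
    field_simp
    unfold DD qq
    ring

/-- clamp to an interval -/
def clampR (a R t : ℝ) : ℝ := max (min t (a + R)) (a - R)

lemma clampR_lip (a R : ℝ) : LipschitzWith 1 (clampR a R) := by
  exact (LipschitzWith.id.min_const _).max_const _

lemma clampR_mem {a R : ℝ} (hR : 0 < R) (t : ℝ) : clampR a R t ∈ Set.Icc (a - R) (a + R) := by
  unfold clampR
  constructor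
  · exact le_max_right _ _
  · exact max_le (min_le_right _ _) (by linarith)

lemma clampR_cases {a R : ℝ} (hR : 0 < R) (t : ℝ) :
    clampR a R t = t ∨ (R ^ 2 ≤ (t - a) ^ 2 ∧ (clampR a R t - a) ^ 2 = R ^ 2) := by
  unfold clampR
  rcases le_total t (a + R) with h | h
  · rw [min_eq_left h]
    rcases le_total t (a - R) with h' | h'
    · rw [max_eq_right h']; right; constructor <;> nlinarith
    · rw [max_eq_left h']; left; rfl
  · rw [min_eq_right h, max_eq_left (by linarith)]; right; constructor <;> nlinarith

lemma MM_lip {a b R l : ℝ} (hR : 0 < R) (hl : 0 < l) : ∃ K, LipschitzWith K (MM a b R l) := by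
  obtain ⟨K, hK⟩ := ((MM_locLip (a := a) (b := b) hR hl).locallyLipschitzOn
    (s := Set.Icc (a - R) (a + R) ×ˢ Set.Icc (b - R) (b + R))).exists_lipschitzOnWith_of_compact
    (isCompact_Icc.prod isCompact_Icc)
  have hc : LipschitzWith 1 (fun x : ℝ × ℝ => (clampR a R x.1, clampR b R x.2)) := by
    have h1 := (clampR_lip a R).comp (LipschitzWith.prod_fst (α := ℝ) (β := ℝ))
    have h2 := (clampR_lip b R).comp (LipschitzWith.prod_snd (α := ℝ) (β := ℝ))
    simpa using! h1.prodMk h2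
  have he : MM a b R l = MM a b R l ∘ (fun x : ℝ × ℝ => (clampR a R x.1, clampR b R x.2)) := by
    ext1 x
    have key : (clampR a R x.1 = x.1 ∧ clampR b R x.2 = x.2) ∨
        (R ^ 2 ≤ qq a b x ∧ R ^ 2 ≤ qq a b (clampR a R x.1, clampR b R x.2)) := by
      unfold qq
      rcases clampR_cases (a := a) hR x.1 with h1 | h1 <;>
      rcases clampR_cases (a := b) hR x.2 with h2 | h2
      · exact Or.inl ⟨h1, h2⟩
      all_goals
        right
        constructor <;> nlinarith [sq_nonneg (x.1 - a), sq_nonneg (x.2 - b),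
          sq_nonneg (clampR a R x.1 - a), sq_nonneg (clampR b R x.2 - b)]
    rcases key with ⟨h1, h2⟩ | ⟨h1, h2⟩
    · simp [h1, h2]
    · rw [Function.comp, MM_out h1, MM_out h2]
  refine ⟨K * 1, ?_⟩
  rw [he, ← lipschitzOnWith_univ]
  exact hK.comp (lipschitzOnWith_univ.2 hc) (fun x _ => ⟨clampR_mem hR _, clampR_mem hR _⟩)
lemma pd1_eq {F : ℝ × ℝ → Fin 3 → ℝ} {x : ℝ × ℝ} (hF : DifferentiableAt ℝ F x) {i : Fin 3} {d : ℝ}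
    (h : HasDerivAt (fun s => F (s, x.2) i) d x.1) : pd1 F x i = d := by
  have h1 : HasDerivAt (fun s : ℝ => (s, x.2)) ((1 : ℝ), (0 : ℝ)) x.1 :=
    (hasDerivAt_id x.1).prodMk (hasDerivAt_const x.1 x.2)
  have h2 := (HasFDerivAt.comp_hasDerivAt x.1 (f := fun s : ℝ => (s, x.2)) (l := F) hF.hasFDerivAt h1)
  exact ((hasDerivAt_pi.1 h2) i).unique h

lemma pd2_eq {F : ℝ × ℝ → Fin 3 → ℝ} {x : ℝ × ℝ} (hF : DifferentiableAt ℝ F x) {i : Fin 3} {d : ℝ}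
    (h : HasDerivAt (fun s => F (x.1, s) i) d x.2) : pd2 F x i = d := by
  have h1 : HasDerivAt (fun s : ℝ => (x.1, s)) ((0 : ℝ), (1 : ℝ)) x.2 :=
    (hasDerivAt_const x.2 x.1).prodMk (hasDerivAt_id x.2)
  have h2 := (HasFDerivAt.comp_hasDerivAt x.2 (f := fun s : ℝ => (x.1, s)) (l := F) hF.hasFDerivAt h1)
  exact ((hasDerivAt_pi.1 h2) i).unique h

lemma hasDerivAt_qq1 (a b : ℝ) (x : ℝ × ℝ) :
    HasDerivAt (fun s => qq a b (s, x.2)) (2 * (x.1 - a)) x.1 := by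
  unfold qq
  have := ((hasDerivAt_id x.1).sub_const a).pow 2
  simpa using this.add_const ((x.2 - b) ^ 2)

lemma hasDerivAt_qq2 (a b : ℝ) (x : ℝ × ℝ) :
    HasDerivAt (fun s => qq a b (x.1, s)) (2 * (x.2 - b)) x.2 := by
  unfold qq
  have := ((hasDerivAt_id x.2).sub_const b).pow 2
  simpa using this.const_add ((x.1 - a) ^ 2)

lemma deriv_pack {f : ℝ → ℝ} {t d R l : ℝ} (hf : HasDerivAt f d t) :
    HasDerivAt (fun s => l ^ 2 * (R ^ 2 - f s) ^ 2 + f s) (d * (1 - 2 * l ^ 2 * (R ^ 2 - f t))) t := by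
  have := (((hf.const_sub (R ^ 2)).pow 2).const_mul (l ^ 2)).add hf
  refine this.congr_deriv ?_
  push_cast; ring


lemma FF_pd1_0 {a b R l : ℝ} (hR : 0 < R) (hl : 0 < l) (x : ℝ × ℝ) :
    pd1 (FF a b R l) x 0 =
    -2 * l * ((R ^ 2 - qq a b x - 2 * (x.1 - a) ^ 2) * DD a b R l x
      - (R ^ 2 - qq a b x) * (x.1 - a) * (2 * (x.1 - a) * (1 - 2 * l ^ 2 * (R ^ 2 - qq a b x))))
      / DD a b R l x ^ 2 := by
  apply pd1_eq ((FF_contDiff hR hl).differentiable one_ne_zero x)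
  have h1 := hasDerivAt_qq1 a b x
  have h2 : HasDerivAt (fun s => DD a b R l (s, x.2)) _ x.1 := deriv_pack (R := R) (l := l) h1
  have h3 := ((((h1.const_sub (R ^ 2)).const_mul (-2 * l)).mul
    ((hasDerivAt_id x.1).sub_const a))).div h2 (DD_pos hR hl _).ne'
  refine h3.congr_deriv ?_
  simp only [id, Pi.mul_apply]; ring

lemma FF_pd1_1 {a b R l : ℝ} (hR : 0 < R) (hl : 0 < l) (x : ℝ × ℝ) :
    pd1 (FF a b R l) x 1 =
    -2 * l * ((- 2 * (x.1 - a) * (x.2 - b)) * DD a b R l x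
      - (R ^ 2 - qq a b x) * (x.2 - b) * (2 * (x.1 - a) * (1 - 2 * l ^ 2 * (R ^ 2 - qq a b x))))
      / DD a b R l x ^ 2 := by
  apply pd1_eq ((FF_contDiff hR hl).differentiable one_ne_zero x)
  have h1 := hasDerivAt_qq1 a b x
  have h2 : HasDerivAt (fun s => DD a b R l (s, x.2)) _ x.1 := deriv_pack (R := R) (l := l) h1
  have h3 := ((((h1.const_sub (R ^ 2)).const_mul (-2 * l)).mul_const (x.2 - b))).div h2
    (DD_pos hR hl _).ne'
  refine h3.congr_deriv ?_
  ring

lemma FF_pd1_2 {a b R l : ℝ} (hR : 0 < R) (hl : 0 < l) (x : ℝ × ℝ) :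
    pd1 (FF a b R l) x 2 =
    2 * l ^ 2 * ((2 * (R ^ 2 - qq a b x) * (- 2 * (x.1 - a))) * DD a b R l x
      - (R ^ 2 - qq a b x) ^ 2 * (2 * (x.1 - a) * (1 - 2 * l ^ 2 * (R ^ 2 - qq a b x))))
      / DD a b R l x ^ 2 := by
  apply pd1_eq ((FF_contDiff hR hl).differentiable one_ne_zero x)
  have h1 := hasDerivAt_qq1 a b x
  have h2 : HasDerivAt (fun s => DD a b R l (s, x.2)) _ x.1 := deriv_pack (R := R) (l := l) h1
  have h3 := ((((h1.const_sub (R ^ 2)).pow 2).const_mul (2 * l ^ 2)).div h2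
    (DD_pos hR hl _).ne').const_add (-1)
  refine h3.congr_deriv ?_
  push_cast; simp only [Pi.pow_apply]; ring

lemma FF_pd2_1 {a b R l : ℝ} (hR : 0 < R) (hl : 0 < l) (x : ℝ × ℝ) :
    pd2 (FF a b R l) x 1 =
    -2 * l * ((R ^ 2 - qq a b x - 2 * (x.2 - b) ^ 2) * DD a b R l x
      - (R ^ 2 - qq a b x) * (x.2 - b) * (2 * (x.2 - b) * (1 - 2 * l ^ 2 * (R ^ 2 - qq a b x))))
      / DD a b R l x ^ 2 := by
  apply pd2_eq ((FF_contDiff hR hl).differentiable one_ne_zero x)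
  have h1 := hasDerivAt_qq2 a b x
  have h2 : HasDerivAt (fun s => DD a b R l (x.1, s)) _ x.2 := deriv_pack (R := R) (l := l) h1
  have h3 := ((((h1.const_sub (R ^ 2)).const_mul (-2 * l)).mul
    ((hasDerivAt_id x.2).sub_const b))).div h2 (DD_pos hR hl _).ne'
  refine h3.congr_deriv ?_
  simp only [id, Pi.mul_apply]; ring

lemma FF_pd2_0 {a b R l : ℝ} (hR : 0 < R) (hl : 0 < l) (x : ℝ × ℝ) :
    pd2 (FF a b R l) x 0 =
    -2 * l * ((- 2 * (x.2 - b) * (x.1 - a)) * DD a b R l x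
      - (R ^ 2 - qq a b x) * (x.1 - a) * (2 * (x.2 - b) * (1 - 2 * l ^ 2 * (R ^ 2 - qq a b x))))
      / DD a b R l x ^ 2 := by
  apply pd2_eq ((FF_contDiff hR hl).differentiable one_ne_zero x)
  have h1 := hasDerivAt_qq2 a b x
  have h2 : HasDerivAt (fun s => DD a b R l (x.1, s)) _ x.2 := deriv_pack (R := R) (l := l) h1
  have h3 := ((((h1.const_sub (R ^ 2)).const_mul (-2 * l)).mul_const (x.1 - a))).div h2
    (DD_pos hR hl _).ne'
  refine h3.congr_deriv ?_
  ring

lemma FF_pd2_2 {a b R l : ℝ} (hR : 0 < R) (hl : 0 < l) (x : ℝ × ℝ) :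
    pd2 (FF a b R l) x 2 =
    2 * l ^ 2 * ((2 * (R ^ 2 - qq a b x) * (- 2 * (x.2 - b))) * DD a b R l x
      - (R ^ 2 - qq a b x) ^ 2 * (2 * (x.2 - b) * (1 - 2 * l ^ 2 * (R ^ 2 - qq a b x))))
      / DD a b R l x ^ 2 := by
  apply pd2_eq ((FF_contDiff hR hl).differentiable one_ne_zero x)
  have h1 := hasDerivAt_qq2 a b x
  have h2 : HasDerivAt (fun s => DD a b R l (x.1, s)) _ x.2 := deriv_pack (R := R) (l := l) h1
  have h3 := ((((h1.const_sub (R ^ 2)).pow 2).const_mul (2 * l ^ 2)).div h2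
    (DD_pos hR hl _).ne').const_add (-1)
  refine h3.congr_deriv ?_
  push_cast; simp only [Pi.pow_apply]; ring

/-- Jacobian density of the model map. -/
lemma FF_jac {a b R l : ℝ} (hR : 0 < R) (hl : 0 < l) (x : ℝ × ℝ) :
    ∑ i, FF a b R l x i * cross3 (pd1 (FF a b R l) x) (pd2 (FF a b R l) x) i
    = 4 * l ^ 2 * (R ^ 2 - qq a b x) * (R ^ 2 + qq a b x) / DD a b R l x ^ 2 := by
  have hD := (DD_pos (a := a) (b := b) hR hl x).ne'
  simp only [Fin.sum_univ_three, cross3, Matrix.cons_val_zero, Matrix.cons_val_one,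
      Matrix.cons_val]
  rw [FF_pd1_0 hR hl, FF_pd1_1 hR hl, FF_pd1_2 hR hl, FF_pd2_0 hR hl, FF_pd2_1 hR hl,
    FF_pd2_2 hR hl]
  simp only [FF, GG, Matrix.cons_val_zero, Matrix.cons_val_one, Matrix.cons_val]
  have hDe : DD a b R l x = l ^ 2 * (R ^ 2 - qq a b x) ^ 2 + ((x.1 - a) ^ 2 + (x.2 - b) ^ 2) := rfl
  have hqe : qq a b x = (x.1 - a) ^ 2 + (x.2 - b) ^ 2 := rfl
  generalize DD a b R l x = D at *
  generalize qq a b x = q at *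
  generalize x.1 - a = S at *
  generalize x.2 - b = T at *
  obtain ⟨w, hw⟩ : ∃ w, w = R ^ 2 - q := ⟨_, rfl⟩
  have hR2 : R ^ 2 = w + q := by linarith
  simp only [hR2, add_sub_cancel_right] at hDe ⊢
  clear hR2 hw
  field_simp
  subst hDe hqe
  ring

lemma FF_grad {a b R l : ℝ} (hR : 0 < R) (hl : 0 < l) (x : ℝ × ℝ) :
    gradSq (FF a b R l) x
    = 2 * (4 * l ^ 2 * (R ^ 2 - qq a b x) * (R ^ 2 + qq a b x) / DD a b R l x ^ 2)
      + 16 * l ^ 2 * qq a b x ^ 2 / DD a b R l x ^ 2 := by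
  have hD := (DD_pos (a := a) (b := b) hR hl x).ne'
  simp only [gradSq, Fin.sum_univ_three]
  rw [FF_pd1_0 hR hl, FF_pd1_1 hR hl, FF_pd1_2 hR hl, FF_pd2_0 hR hl, FF_pd2_1 hR hl,
    FF_pd2_2 hR hl]
  have hDe : DD a b R l x = l ^ 2 * (R ^ 2 - qq a b x) ^ 2 + ((x.1 - a) ^ 2 + (x.2 - b) ^ 2) := rfl
  have hqe : qq a b x = (x.1 - a) ^ 2 + (x.2 - b) ^ 2 := rfl
  generalize DD a b R l x = D at *
  generalize qq a b x = q at *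
  generalize x.1 - a = S at *
  generalize x.2 - b = T at *
  obtain ⟨w, hw⟩ : ∃ w, w = R ^ 2 - q := ⟨_, rfl⟩
  have hR2 : R ^ 2 = w + q := by linarith
  simp only [hR2, add_sub_cancel_right] at hDe ⊢
  clear hR2 hw
  field_simp
  subst hDe hqe
  ring

lemma FF_dmi {a b R l : ℝ} (hR : 0 < R) (hl : 0 < l) (x : ℝ × ℝ) :
    dmiDens (FF a b R l) x
    = 8 * l ^ 3 * (R ^ 2 - qq a b x) ^ 2 * (R ^ 2 + qq a b x) * qq a b x / DD a b R l x ^ 3 := by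
  have hD := (DD_pos (a := a) (b := b) hR hl x).ne'
  simp only [dmiDens]
  rw [FF_pd1_2 hR hl, FF_pd2_2 hR hl]
  simp only [FF, GG, Matrix.cons_val_zero, Matrix.cons_val_one, Matrix.cons_val]
  have hDe : DD a b R l x = l ^ 2 * (R ^ 2 - qq a b x) ^ 2 + ((x.1 - a) ^ 2 + (x.2 - b) ^ 2) := rfl
  have hqe : qq a b x = (x.1 - a) ^ 2 + (x.2 - b) ^ 2 := rfl
  generalize DD a b R l x = D at *
  generalize qq a b x = q at *
  generalize x.1 - a = S at *
  generalize x.2 - b = T at *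
  obtain ⟨w, hw⟩ : ∃ w, w = R ^ 2 - q := ⟨_, rfl⟩
  have hR2 : R ^ 2 = w + q := by linarith
  simp only [hR2, add_sub_cancel_right] at hDe ⊢
  clear hR2 hw
  field_simp
  subst hDe hqe
  ring

/-- Jacobian density -/
def Jd (a b R l : ℝ) (x : ℝ × ℝ) : ℝ :=
  4 * l ^ 2 * (R ^ 2 - qq a b x) * (R ^ 2 + qq a b x) / DD a b R l x ^ 2

/-- excess density -/
def Xd (a b R l : ℝ) (x : ℝ × ℝ) : ℝ := 16 * l ^ 2 * qq a b x ^ 2 / DD a b R l x ^ 2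

/-- DMI density -/
def Md (a b R l : ℝ) (x : ℝ × ℝ) : ℝ :=
  8 * l ^ 3 * (R ^ 2 - qq a b x) ^ 2 * (R ^ 2 + qq a b x) * qq a b x / DD a b R l x ^ 3

/-- open disc -/
def BB (a b R : ℝ) : Set (ℝ × ℝ) := {x | qq a b x < R ^ 2}

lemma qq_cont (a b : ℝ) : Continuous (qq a b) := (qq_contDiff a b).continuous
lemma DD_cont (a b R l : ℝ) : Continuous (DD a b R l) := (DD_contDiff a b R l).continuous

lemma BB_open (a b R : ℝ) : IsOpen (BB a b R) := isOpen_lt (qq_cont a b) continuous_const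

lemma BB_sub {a b R : ℝ} (hR : 0 < R) :
    BB a b R ⊆ Set.Icc (a - R) (a + R) ×ˢ Set.Icc (b - R) (b + R) := by
  intro x hx
  simp only [BB, qq, Set.mem_ofPred_eq] at hx
  have h1 : |x.1 - a| ≤ R := abs_le_of_sq_le_sq (by nlinarith [sq_nonneg (x.2 - b)]) hR.le
  have h2 : |x.2 - b| ≤ R := abs_le_of_sq_le_sq (by nlinarith [sq_nonneg (x.1 - a)]) hR.le
  rw [abs_le] at h1 h2
  exact ⟨⟨by linarith, by linarith⟩, ⟨by linarith, by linarith⟩⟩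

lemma ae_ne (a b : ℝ) {R : ℝ} (hR : 0 < R) : ∀ᵐ x : ℝ × ℝ, qq a b x ≠ R ^ 2 := by
  rw [ae_iff]
  simp only [not_not]
  have h := Complex.volume_preserving_equiv_real_prod.symm.measure_preimage
    (s := Metric.sphere (⟨a, b⟩ : ℂ) R) Metric.isClosed_sphere.measurableSet.nullMeasurableSet
  rw [Measure.addHaar_sphere] at h
  refine measure_mono_null ?_ h
  intro x hx
  have hx' : qq a b x = R ^ 2 := hx
  change dist (Complex.measurableEquivRealProd.symm x) (⟨a, b⟩ : ℂ) = R
  rw [Complex.dist_eq_re_im]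
  change √ (qq a b x) = R
  rw [hx', Real.sqrt_sq hR.le]

lemma fderiv_in {a b R l : ℝ} {x : ℝ × ℝ} (hx : qq a b x < R ^ 2) :
    fderiv ℝ (MM a b R l) x = fderiv ℝ (FF a b R l) x := by
  apply Filter.EventuallyEq.fderiv_eq
  filter_upwards [(BB_open a b R).mem_nhds hx] with y hy
  exact MM_in (le_of_lt hy)

lemma fderiv_out {a b R l : ℝ} {x : ℝ × ℝ} (hx : R ^ 2 < qq a b x) :
    fderiv ℝ (MM a b R l) x = 0 := by
  have : MM a b R l =ᶠ[nhds x] fun _ => -e3 := by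
    filter_upwards [(isOpen_lt continuous_const (qq_cont a b)).mem_nhds hx] with y hy
    exact MM_out (le_of_lt hy)
  rw [this.fderiv_eq]; simp

lemma jac_ae {a b R l : ℝ} (hR : 0 < R) (hl : 0 < l) :
    (fun x => ∑ i, MM a b R l x i * cross3 (pd1 (MM a b R l) x) (pd2 (MM a b R l) x) i)
      =ᵐ[volume] (BB a b R).indicator (Jd a b R l) := by
  filter_upwards [ae_ne a b hR] with x hx
  rcases lt_or_gt_of_ne hx with h | h
  · rw [Set.indicator_of_mem (show x ∈ BB a b R from h), Jd, ← FF_jac hR hl]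
    simp only [pd1, pd2, fderiv_in h, MM_in h.le]
  · rw [Set.indicator_of_notMem (show x ∉ BB a b R from not_lt.2 h.le)]
    simp [pd1, pd2, fderiv_out h, cross3, Fin.sum_univ_three]

lemma en_ae {a b R l : ℝ} (κ : ℝ) (hR : 0 < R) (hl : 0 < l) :
    (fun x => gradSq (MM a b R l) x - 2 * κ * dmiDens (MM a b R l) x)
      =ᵐ[volume] (BB a b R).indicator
        (fun x => 2 * Jd a b R l x + Xd a b R l x - 2 * κ * Md a b R l x) := by
  filter_upwards [ae_ne a b hR] with x hx
  rcases lt_or_gt_of_ne hx with h | h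
  · rw [Set.indicator_of_mem (show x ∈ BB a b R from h), Jd, Xd, Md, ← FF_grad hR hl,
      ← FF_dmi hR hl]
    simp only [gradSq, dmiDens, pd1, pd2, fderiv_in h, MM_in h.le]
  · rw [Set.indicator_of_notMem (show x ∉ BB a b R from not_lt.2 h.le)]
    simp [gradSq, dmiDens, pd1, pd2, fderiv_out h]

lemma Jd_cont {a b R l : ℝ} (hR : 0 < R) (hl : 0 < l) : Continuous (Jd a b R l) := by
  have := qq_cont a b
  have h2 := DD_cont a b R l
  unfold Jd
  exact Continuous.div (by fun_prop) (by fun_prop) (fun x => (pow_pos (DD_pos hR hl x) _).ne')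

lemma Xd_cont {a b R l : ℝ} (hR : 0 < R) (hl : 0 < l) : Continuous (Xd a b R l) := by
  have := qq_cont a b
  have h2 := DD_cont a b R l
  unfold Xd
  exact Continuous.div (by fun_prop) (by fun_prop) (fun x => (pow_pos (DD_pos hR hl x) _).ne')

lemma Md_cont {a b R l : ℝ} (hR : 0 < R) (hl : 0 < l) : Continuous (Md a b R l) := by
  have := qq_cont a b
  have h2 := DD_cont a b R l
  unfold Md
  exact Continuous.div (by fun_prop) (by fun_prop) (fun x => (pow_pos (DD_pos hR hl x) _).ne')

lemma intOn_BB {a b R : ℝ} (hR : 0 < R) {f : ℝ × ℝ → ℝ} (hf : Continuous f) :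
    IntegrableOn f (BB a b R) :=
  (hf.continuousOn.integrableOn_compact (isCompact_Icc.prod isCompact_Icc)).mono_set (BB_sub hR)

lemma radial_int {R l : ℝ} (hR : 0 < R) (hl : 0 < l) :
    ∫ r in (0 : ℝ)..R, r * (4 * l ^ 2 * (R ^ 2 - r ^ 2) * (R ^ 2 + r ^ 2)
      / (l ^ 2 * (R ^ 2 - r ^ 2) ^ 2 + r ^ 2) ^ 2) = 2 := by
  have hpos : ∀ r : ℝ, 0 < l ^ 2 * (R ^ 2 - r ^ 2) ^ 2 + r ^ 2 := by
    intro r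
    have := DD_pos (a := 0) (b := 0) hR hl (r, 0)
    simpa [DD, qq] using this
  have hd : ∀ r : ℝ, HasDerivAt (fun r => 2 * (r ^ 2 / (l ^ 2 * (R ^ 2 - r ^ 2) ^ 2 + r ^ 2)))
      (r * (4 * l ^ 2 * (R ^ 2 - r ^ 2) * (R ^ 2 + r ^ 2)
      / (l ^ 2 * (R ^ 2 - r ^ 2) ^ 2 + r ^ 2) ^ 2)) r := by
    intro r
    have h1 : HasDerivAt (fun r : ℝ => r ^ 2) (2 * r) r := by simpa using hasDerivAt_pow 2 r
    have h2 := deriv_pack (R := R) (l := l) h1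
    refine ((h1.div h2 (hpos r).ne').const_mul 2).congr_deriv ?_
    have := (hpos r).ne'
    field_simp
    ring
  rw [intervalIntegral.integral_eq_sub_of_hasDerivAt (fun r _ => hd r)]
  · have : R ^ 2 ≠ 0 := by positivity
    simp [this]
  · apply Continuous.intervalIntegrable
    exact continuous_id.mul (Continuous.div (by fun_prop) (by fun_prop)
      (fun r => (pow_pos (hpos r) 2).ne'))

lemma int_J {a b R l : ℝ} (hR : 0 < R) (hl : 0 < l) :
    ∫ x in BB a b R, Jd a b R l x = 4 * π := by
  rw [← integral_indicator (BB_open a b R).measurableSet]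
  have h1 : (BB a b R).indicator (Jd a b R l) =
      fun x => (BB 0 0 R).indicator (Jd 0 0 R l) (x - (a, b)) := by
    ext x
    simp only [Set.indicator, BB, Jd, DD, qq, Set.mem_ofPred_eq, Prod.fst_sub, Prod.snd_sub,
      sub_zero]
    congr
  rw [h1, integral_sub_right_eq_self, ← integral_comp_polarCoord_symm]
  let h : ℝ → ℝ := (Set.Iio R).indicator (fun r => r * (4 * l ^ 2 * (R ^ 2 - r ^ 2) * (R ^ 2 + r ^ 2)
      / (l ^ 2 * (R ^ 2 - r ^ 2) ^ 2 + r ^ 2) ^ 2))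
  have h2 : ∫ p in polarCoord.target, p.1 • (BB 0 0 R).indicator (Jd 0 0 R l) (polarCoord.symm p)
      = ∫ p in Set.Ioi (0 : ℝ) ×ˢ Set.Ioo (-π) π, h p.1 * (fun _ => (1 : ℝ)) p.2 := by
    rw [polarCoord_target]
    apply setIntegral_congr_fun (measurableSet_Ioi.prod measurableSet_Ioo)
    rintro ⟨r, θ⟩ ⟨hr, -⟩
    have hr : 0 < r := hr
    have hq : qq 0 0 (polarCoord.symm (r, θ)) = r ^ 2 := by
      simp only [polarCoord_symm_apply, qq, sub_zero]
      nlinarith [Real.sin_sq_add_cos_sq θ]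
    have hiff : polarCoord.symm (r, θ) ∈ BB 0 0 R ↔ r ∈ Set.Iio R := by
      simp only [BB, Set.mem_ofPred_eq, hq, Set.mem_Iio]
      exact pow_lt_pow_iff_left₀ hr.le hR.le two_ne_zero
    by_cases hm : r ∈ Set.Iio R
    · simp only [h, Set.indicator_of_mem hm, Set.indicator_of_mem (hiff.2 hm), Jd, DD, hq,
        smul_eq_mul, mul_one]
    · simp only [h, Set.indicator_of_notMem hm, Set.indicator_of_notMem (fun h' => hm (hiff.1 h')),
        smul_eq_mul, mul_one, mul_zero]
  rw [h2, Measure.volume_eq_prod,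
    setIntegral_prod_mul (μ := volume) (ν := volume) h (fun _ => (1 : ℝ))]
  have h3 : ∫ r in Set.Ioi (0 : ℝ), h r = 2 := by
    rw [setIntegral_indicator measurableSet_Iio, Set.Ioi_inter_Iio, ← integral_Ioc_eq_integral_Ioo,
      ← intervalIntegral.integral_of_le hR.le, radial_int hR hl]
  rw [h3]
  simp [Real.pi_pos.le]
  ring

lemma int_X {a b R l : ℝ} (hR : 0 < R) (hl : 0 < l) :
    ∫ x in BB a b R, Xd a b R l x ≤ 64 * l ^ 2 * R ^ 2 := by
  have hX : ∀ x, Xd a b R l x ≤ 16 * l ^ 2 := by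
    intro x
    have hD := DD_pos (a := a) (b := b) hR hl x
    have hq := qq_nonneg a b x
    have hqD : qq a b x ≤ DD a b R l x := by unfold DD; nlinarith [sq_nonneg (l * (R ^ 2 - qq a b x))]
    unfold Xd
    rw [div_le_iff₀ (by positivity)]
    gcongr
  have hX0 : ∀ x, 0 ≤ Xd a b R l x := by intro x; unfold Xd; positivity
  calc ∫ x in BB a b R, Xd a b R l x
      ≤ ∫ x in Set.Icc (a - R) (a + R) ×ˢ Set.Icc (b - R) (b + R), Xd a b R l x :=
        setIntegral_mono_set ((Xd_cont hR hl).continuousOn.integrableOn_compact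
          (isCompact_Icc.prod isCompact_Icc)) (Filter.Eventually.of_forall hX0)
          (BB_sub hR).eventuallyLE
    _ ≤ ∫ x in Set.Icc (a - R) (a + R) ×ˢ Set.Icc (b - R) (b + R), 16 * l ^ 2 :=
        setIntegral_mono ((Xd_cont hR hl).continuousOn.integrableOn_compact
          (isCompact_Icc.prod isCompact_Icc)) (continuous_const.continuousOn.integrableOn_compact
          (isCompact_Icc.prod isCompact_Icc)) hX
    _ = 64 * l ^ 2 * R ^ 2 := by
        rw [setIntegral_const, Measure.volume_eq_prod, measureReal_prod_prod]
        simp only [Real.volume_real_Icc, smul_eq_mul]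
        rw [max_eq_left (by linarith), max_eq_left (by linarith)]
        ring

lemma int_M {a b R l : ℝ} (hR : 0 < R) (hl : 0 < l) (hlR : l * R ≤ 1 / 2) :
    l * R ^ 2 / 100 ≤ ∫ x in BB a b R, Md a b R l x := by
  have hM0 : ∀ x, x ∈ BB a b R → 0 ≤ Md a b R l x := by
    intro x hx
    have := (DD_pos (a := a) (b := b) hR hl x)
    have := qq_nonneg a b x
    unfold Md; positivity
  obtain ⟨L, hL⟩ : ∃ L, L = l * R ^ 2 := ⟨_, rfl⟩
  have hLp : 0 < L := by rw [hL]; positivity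
  have hLR : L ≤ R / 2 := by rw [hL]; nlinarith
  rw [← hL]
  set S := Set.Icc (a + L / 2) (a + L) ×ˢ Set.Icc b (b + L / 2) with hS
  have hq : ∀ x ∈ S, L ^ 2 / 4 ≤ qq a b x ∧ qq a b x ≤ 5 / 4 * L ^ 2 := by
    rintro x ⟨⟨h1, h2⟩, ⟨h3, h4⟩⟩
    unfold qq
    constructor <;> nlinarith
  have hLL : L ^ 2 ≤ R ^ 2 / 4 := by nlinarith
  have hsub : S ⊆ BB a b R := by
    intro x hx
    have := (hq x hx).2
    simp only [BB, Set.mem_ofPred_eq]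
    nlinarith [sq_pos_of_pos hR]
  have hlow : ∀ x ∈ S, 1 / (25 * L) ≤ Md a b R l x := by
    intro x hx
    obtain ⟨h1, h2⟩ := hq x hx
    have hD := (DD_pos (a := a) (b := b) hR hl x)
    have hw1 : R ^ 2 / 2 ≤ R ^ 2 - qq a b x := by nlinarith [sq_pos_of_pos hR]
    have hw2 : R ^ 2 - qq a b x ≤ R ^ 2 := by linarith [qq_nonneg a b x]
    have hDle : DD a b R l x ≤ 9 / 4 * L ^ 2 := by
      have : l ^ 2 * (R ^ 2 - qq a b x) ^ 2 ≤ L ^ 2 := by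
        rw [← mul_pow, hL]
        have : 0 ≤ R ^ 2 - qq a b x := by nlinarith [sq_pos_of_pos hR]
        gcongr
      unfold DD; linarith
    unfold Md
    rw [div_le_div_iff₀ (by positivity) (by positivity)]
    have e1 : DD a b R l x ^ 3 ≤ (9 / 4 * L ^ 2) ^ 3 := by gcongr
    have e2 : 8 * l ^ 3 * (R ^ 2 / 2) ^ 2 * (R ^ 2 + 0) * (L ^ 2 / 4) ≤
        8 * l ^ 3 * (R ^ 2 - qq a b x) ^ 2 * (R ^ 2 + qq a b x) * qq a b x := by
      have := qq_nonneg a b x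
      gcongr
    have e3 : 8 * l ^ 3 * (R ^ 2 / 2) ^ 2 * (R ^ 2 + 0) * (L ^ 2 / 4) = L ^ 5 / 2 := by
      rw [hL]; ring
    rw [e3] at e2
    have e4 : L ^ 5 / 2 * (25 * L) ≤ (8 * l ^ 3 * (R ^ 2 - qq a b x) ^ 2 * (R ^ 2 + qq a b x) *
      qq a b x) * (25 * L) := by gcongr
    have : 0 < L ^ 6 := by positivity
    nlinarith
  have hSc : IsCompact S := isCompact_Icc.prod isCompact_Icc
  calc L / 100 = ∫ x in S, 1 / (25 * L) := by
        rw [setIntegral_const, hS, Measure.volume_eq_prod, measureReal_prod_prod]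
        simp only [Real.volume_real_Icc, smul_eq_mul]
        rw [max_eq_left (by linarith), max_eq_left (by linarith)]
        field_simp
        ring
    _ ≤ ∫ x in S, Md a b R l x :=
        setIntegral_mono_on (continuous_const.continuousOn.integrableOn_compact hSc)
          ((Md_cont hR hl).continuousOn.integrableOn_compact hSc) hSc.measurableSet hlow
    _ ≤ ∫ x in BB a b R, Md a b R l x :=
        setIntegral_mono_set (intOn_BB hR (Md_cont hR hl))
          ((ae_restrict_iff' (BB_open a b R).measurableSet).2 (Filter.Eventually.of_forall hM0))
          hsub.eventuallyLE

lemma MM_degree {a b R l : ℝ} (hR : 0 < R) (hl : 0 < l) : degree (MM a b R l) = 1 := by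
  unfold degree
  rw [integral_congr_ae (jac_ae hR hl), integral_indicator (BB_open a b R).measurableSet,
    int_J hR hl]
  field_simp

lemma MM_energy {a b R l κ : ℝ} (hR : 0 < R) (hl : 0 < l) (hlR : l * R ≤ 1 / 2) (hκ : 0 < κ)
    {Ω : Set (ℝ × ℝ)} (hΩ : BB a b R ⊆ Ω) :
    energy κ Ω (MM a b R l) ≤ 8 * π + 64 * l ^ 2 * R ^ 2 - 2 * κ * (l * R ^ 2 / 100) := by
  unfold energy
  rw [integral_congr_ae (ae_restrict_of_ae (en_ae κ hR hl)),
    setIntegral_indicator (BB_open a b R).measurableSet, Set.inter_eq_right.2 hΩ]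
  have iJ := (intOn_BB (a := a) (b := b) hR (Jd_cont (a := a) (b := b) hR hl)).const_mul 2
  have iX := intOn_BB (a := a) (b := b) hR (Xd_cont (a := a) (b := b) hR hl)
  have iM := (intOn_BB (a := a) (b := b) hR (Md_cont (a := a) (b := b) hR hl)).const_mul (2 * κ)
  have iJX : Integrable (fun x => 2 * Jd a b R l x + Xd a b R l x)
    (volume.restrict (BB a b R)) := iJ.add iX
  rw [integral_sub iJX iM, integral_add iJ iX, integral_const_mul, integral_const_mul,
    int_J hR hl]
  have h1 := int_X (a := a) (b := b) hR hl
  have h2 := mul_le_mul_of_nonneg_left (int_M (a := a) (b := b) hR hl hlR)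
    (by positivity : 0 ≤ 2 * κ)
  linarith

/-- for a nonempty bounded open `Ω ⊂ ℝ²` there are constants
`C > 0` and `κ₀ > 0` (depending only on `Ω`) such that for every `κ ∈ (0, κ₀)`
there is a Lipschitz sphere-valued map `m`, equal to `−e₃` off `Ω`, of degree `1`,
with `E_κ(m) ≤ 8π − Cκ²`. -/
theorem exists_competitor_quadratic_gain (Ω : Set (ℝ × ℝ)) (hΩo : IsOpen Ω)
    (hΩb : Bornology.IsBounded Ω) (hΩne : Ω.Nonempty) :
    ∃ C > (0 : ℝ), ∃ κ₀ > (0 : ℝ), ∀ κ : ℝ, 0 < κ → κ < κ₀ →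
      ∃ m : ℝ × ℝ → Fin 3 → ℝ,
      (∃ K, LipschitzWith K m) ∧
      (∀ x, (∑ i, (m x i) ^ 2) = 1) ∧
      (∀ x ∉ Ω, m x = -e3) ∧
      degree m = 1 ∧
      energy κ Ω m ≤ 8 * π - C * κ ^ 2 := by
  obtain ⟨⟨a, b⟩, hab⟩ := hΩne
  obtain ⟨ε, hε, hball⟩ := Metric.isOpen_iff.1 hΩo (a, b) hab
  obtain ⟨R, hR, hRε⟩ : ∃ R : ℝ, 0 < R ∧ R < ε := ⟨ε / 2, by linarith, by linarith⟩
  have hB : BB a b R ⊆ Ω := by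
    intro x hx
    apply hball
    obtain ⟨⟨h1, h2⟩, ⟨h3, h4⟩⟩ := BB_sub hR hx
    rw [Metric.mem_ball, Prod.dist_eq, Real.dist_eq, Real.dist_eq]
    refine lt_of_le_of_lt ?_ hRε
    exact max_le (abs_le.2 ⟨by simp only; linarith, by simp only; linarith⟩)
      (abs_le.2 ⟨by simp only; linarith, by simp only; linarith⟩)
  refine ⟨R ^ 2 / 640000, by positivity, 3200 / R, by positivity, fun κ hκ hκ0 => ?_⟩
  have hl : 0 < κ / 6400 := by positivity
  have hlR : κ / 6400 * R ≤ 1 / 2 := by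
    rw [lt_div_iff₀ hR] at hκ0
    linarith
  refine ⟨MM a b R (κ / 6400), MM_lip hR hl, MM_unit hR hl, ?_, MM_degree hR hl, ?_⟩
  · intro x hx
    exact MM_out (not_lt.1 fun h => hx (hB h))
  · refine (MM_energy hR hl hlR hκ hB).trans (le_of_eq ?_)
    ring

end
end

section
/- For every R ∈ SO(3) with R e₃ = e₃, one has ∫_{ℝ²} (RΦ)'·∇Φ₃ dx ≤ 4π, with equality if and only if R is the identity. More precisely, if R restricted to the horizontal plane acts as the rotation of ℝ² by angle θ, then ∫_{ℝ²} (RΦ)'·∇Φ₃ dx = 4π cos θ. -/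
open MeasureTheory Real

noncomputable section

/-- The Belavin–Polyakov profile
`Φ(x) = (−2x/(1+|x|²), (1−|x|²)/(1+|x|²))`. -/
def BP (x : ℝ × ℝ) : Fin 3 → ℝ :=
  ![-2 * x.1 / (1 + x.1 ^ 2 + x.2 ^ 2),
    -2 * x.2 / (1 + x.1 ^ 2 + x.2 ^ 2),
    (1 - (x.1 ^ 2 + x.2 ^ 2)) / (1 + x.1 ^ 2 + x.2 ^ 2)]

lemma BP_aux_pos (x : ℝ × ℝ) : 0 < 1 + x.1 ^ 2 + x.2 ^ 2 := by positivity

lemma BP_aux_fderiv (x v : ℝ × ℝ) :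
    fderiv ℝ BP x v 2 = -4 * (x.1 * v.1 + x.2 * v.2) / (1 + x.1 ^ 2 + x.2 ^ 2) ^ 2 := by
  have hne : (1 + x.1 ^ 2 + x.2 ^ 2) ≠ 0 := (BP_aux_pos x).ne'
  have hd : DifferentiableAt ℝ BP x := by
    rw [differentiableAt_pi]
    intro i
    fin_cases i
    · show DifferentiableAt ℝ (fun x : ℝ × ℝ => -2 * x.1 / (1 + x.1 ^ 2 + x.2 ^ 2)) x
      fun_prop (disch := assumption)
    · show DifferentiableAt ℝ (fun x : ℝ × ℝ => -2 * x.2 / (1 + x.1 ^ 2 + x.2 ^ 2)) x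
      fun_prop (disch := assumption)
    · show DifferentiableAt ℝ
        (fun x : ℝ × ℝ => (1 - (x.1 ^ 2 + x.2 ^ 2)) / (1 + x.1 ^ 2 + x.2 ^ 2)) x
      fun_prop (disch := assumption)
  have h1 : HasDerivAt (fun t : ℝ => BP (x + t • v)) (fderiv ℝ BP x v) 0 := by
    have hl : HasDerivAt (fun t : ℝ => x + t • v) v 0 := by
      simpa using ((hasDerivAt_id (0 : ℝ)).smul_const v).const_add x
    have hf : HasFDerivAt BP (fderiv ℝ BP x) (x + (0 : ℝ) • v) := by
      simpa using hd.hasFDerivAt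
    exact hf.comp_hasDerivAt (0 : ℝ) hl
  have h2 := (hasDerivAt_pi.1 h1) 2
  have ha : HasDerivAt (fun t : ℝ => x.1 + t * v.1) v.1 0 := by
    simpa using ((hasDerivAt_id (0 : ℝ)).mul_const v.1).const_add x.1
  have hb : HasDerivAt (fun t : ℝ => x.2 + t * v.2) v.2 0 := by
    simpa using ((hasDerivAt_id (0 : ℝ)).mul_const v.2).const_add x.2
  have hnum := ((ha.pow 2).add (hb.pow 2)).const_sub 1
  have hden := ((ha.pow 2).const_add 1).add (hb.pow 2)
  have h3 := hnum.div hden (by simpa using hne)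
  have h4 : HasDerivAt (fun t : ℝ => BP (x + t • v) 2) _ 0 := h3
  rw [h2.unique h4]
  simp
  field_simp
  ring

lemma BP_aux_radial :
    ∫ r in Set.Ioi (0 : ℝ), r * (8 * r ^ 2 / (1 + r ^ 2) ^ 3) = 2 := by
  have hderiv : ∀ r ∈ Set.Ioi (0 : ℝ), HasDerivAt
      (fun r : ℝ => 2 * (1 - (1 + r ^ 2)⁻¹) ^ 2) (r * (8 * r ^ 2 / (1 + r ^ 2) ^ 3)) r := by
    intro r _
    have hp : (1 + r ^ 2) ≠ 0 := by positivity
    have h := (((((hasDerivAt_id r).pow 2).const_add 1).inv (by simpa using hp)).const_sub 1).pow 2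
      |>.const_mul 2
    have h5 : HasDerivAt (fun r : ℝ => 2 * (1 - (1 + r ^ 2)⁻¹) ^ 2) _ r := h
    refine h5.congr_deriv ?_
    simp
    field_simp
    ring
  have hlim : Filter.Tendsto (fun r : ℝ => 2 * (1 - (1 + r ^ 2)⁻¹) ^ 2) Filter.atTop (nhds 2) := by
    have h0 : Filter.Tendsto (fun r : ℝ => (1 + r ^ 2)⁻¹) Filter.atTop (nhds 0) :=
      Filter.Tendsto.inv_tendsto_atTop
        (Filter.tendsto_atTop_add_const_left _ 1 (Filter.tendsto_pow_atTop (by norm_num)))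
    have := ((h0.const_sub 1).pow 2).const_mul 2
    simpa using this
  have := integral_Ioi_of_hasDerivAt_of_nonneg (a := (0 : ℝ))
    (g := fun r : ℝ => 2 * (1 - (1 + r ^ 2)⁻¹) ^ 2)
    (by
      have : ∀ r : ℝ, 1 + r ^ 2 ≠ 0 := fun r => by positivity
      exact Continuous.continuousWithinAt (by fun_prop (disch := exact this _)))
    hderiv
    (by
      intro r hr
      have : (0 : ℝ) < r := hr
      positivity) hlim
  rw [this]
  simp

lemma BP_aux_integral :
    ∫ x : ℝ × ℝ, 8 * (x.1 ^ 2 + x.2 ^ 2) / (1 + x.1 ^ 2 + x.2 ^ 2) ^ 3 = 4 * π := by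
  rw [← integral_comp_polarCoord_symm]
  have h : ∀ p : ℝ × ℝ, p.1 • (8 * ((polarCoord.symm p).1 ^ 2 + (polarCoord.symm p).2 ^ 2) /
      (1 + (polarCoord.symm p).1 ^ 2 + (polarCoord.symm p).2 ^ 2) ^ 3)
      = (p.1 * (8 * p.1 ^ 2 / (1 + p.1 ^ 2) ^ 3)) * (1 : ℝ) := by
    intro p
    have hs : (polarCoord.symm p).1 ^ 2 + (polarCoord.symm p).2 ^ 2 = p.1 ^ 2 := by
      rw [polarCoord_symm_apply]
      simp only
      linear_combination p.1 ^ 2 * Real.sin_sq_add_cos_sq p.2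
    rw [add_assoc, hs, smul_eq_mul, mul_one]
  simp_rw [h]
  rw [polarCoord_target, Measure.volume_eq_prod,
    setIntegral_prod_mul (fun r : ℝ => r * (8 * r ^ 2 / (1 + r ^ 2) ^ 3)) (fun _ : ℝ => (1 : ℝ)),
    BP_aux_radial]
  simp [Real.pi_pos.le]
  ring

open Matrix in
/-- for `R ∈ SO(3)` with `R e₃ = e₃`, acting on the horizontal plane
as the rotation by angle `θ`, one has `∫_{ℝ²} (RΦ)'·∇Φ₃ dx = 4π cos θ`; in
particular the integral is `≤ 4π`, with equality iff `R` is the identity. -/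
theorem BP_dmi_rotated (R : Matrix (Fin 3) (Fin 3) ℝ)
    (hR : R * Rᵀ = 1) (hRdet : R.det = 1) (hRe3 : R.mulVec e3 = e3)
    (θ : ℝ)
    (hθ1 : R.mulVec ![1, 0, 0] = ![Real.cos θ, Real.sin θ, 0])
    (hθ2 : R.mulVec ![0, 1, 0] = ![-Real.sin θ, Real.cos θ, 0]) :
    (∫ x : ℝ × ℝ,
        ((R.mulVec (BP x)) 0 * pd1 BP x 2 + (R.mulVec (BP x)) 1 * pd2 BP x 2))
        = 4 * π * Real.cos θ ∧
    (∫ x : ℝ × ℝ,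
        ((R.mulVec (BP x)) 0 * pd1 BP x 2 + (R.mulVec (BP x)) 1 * pd2 BP x 2))
        ≤ 4 * π ∧
    ((∫ x : ℝ × ℝ,
        ((R.mulVec (BP x)) 0 * pd1 BP x 2 + (R.mulVec (BP x)) 1 * pd2 BP x 2))
        = 4 * π ↔ R = 1) := by
  have e00 : R 0 0 = Real.cos θ := by
    simpa [Matrix.mulVec, dotProduct, Fin.sum_univ_three] using congrFun hθ1 0
  have e10 : R 1 0 = Real.sin θ := by
    simpa [Matrix.mulVec, dotProduct, Fin.sum_univ_three] using congrFun hθ1 1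
  have e20 : R 2 0 = 0 := by
    simpa [Matrix.mulVec, dotProduct, Fin.sum_univ_three] using congrFun hθ1 2
  have e01 : R 0 1 = -Real.sin θ := by
    simpa [Matrix.mulVec, dotProduct, Fin.sum_univ_three] using congrFun hθ2 0
  have e11 : R 1 1 = Real.cos θ := by
    simpa [Matrix.mulVec, dotProduct, Fin.sum_univ_three] using congrFun hθ2 1
  have e21 : R 2 1 = 0 := by
    simpa [Matrix.mulVec, dotProduct, Fin.sum_univ_three] using congrFun hθ2 2
  have e02 : R 0 2 = 0 := by
    simpa [Matrix.mulVec, dotProduct, Fin.sum_univ_three, e3] using congrFun hRe3 0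
  have e12 : R 1 2 = 0 := by
    simpa [Matrix.mulVec, dotProduct, Fin.sum_univ_three, e3] using congrFun hRe3 1
  have e22 : R 2 2 = 1 := by
    simpa [Matrix.mulVec, dotProduct, Fin.sum_univ_three, e3] using congrFun hRe3 2
  have key : (∫ x : ℝ × ℝ,
        ((R.mulVec (BP x)) 0 * pd1 BP x 2 + (R.mulVec (BP x)) 1 * pd2 BP x 2))
        = 4 * π * Real.cos θ := by
    rw [← BP_aux_integral, ← integral_mul_const]
    congr 1
    funext x
    have hne : (1 + x.1 ^ 2 + x.2 ^ 2) ≠ 0 := (BP_aux_pos x).ne'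
    simp only [pd1, pd2, BP_aux_fderiv]
    simp [Matrix.mulVec, dotProduct, Fin.sum_univ_three, BP, e00, e10, e01, e11, e02, e12]
    field_simp
    ring
  rw [key]
  have hpi := Real.pi_pos
  refine ⟨rfl, ?_, ?_, ?_⟩
  · nlinarith [Real.cos_le_one θ]
  · intro h
    have hc : Real.cos θ = 1 := by
      have h4 : (4 * π) ≠ 0 := by positivity
      exact mul_left_cancel₀ h4 (by rw [h, mul_one])
    have hs : Real.sin θ = 0 := by
      have := Real.sin_sq_add_cos_sq θ
      rw [hc] at this
      have h2 : Real.sin θ ^ 2 = 0 := by linarith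
      exact pow_eq_zero_iff (two_ne_zero) |>.1 h2
    ext i j
    fin_cases i <;> fin_cases j <;> simp [e00, e01, e02, e10, e11, e12, e20, e21, e22, hc, hs]
  · intro h
    have hc : Real.cos θ = 1 := by rw [← e00, h]; simp
    rw [hc, mul_one]

end
end

section
/- There exists a universal constant C > 0 (one may take C = 8√2 π) such that for every R ∈ SO(3), ∫_{ℝ²} |(R(Φ(x)+e₃))' · ∇(RΦ)₃(x)| dx ≤ C; in particular, |∫_{ℝ²} (R(Φ+e₃))'·∇(RΦ)₃ dx| ≤ C uniformly in R ∈ SO(3). -/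
open MeasureTheory Real

noncomputable section

lemma bp_g_polar :
    ∫ x : ℝ × ℝ, 4 * √2 / ((1 + x.1 ^ 2 + x.2 ^ 2) * √(1 + x.1 ^ 2 + x.2 ^ 2))
      = 8 * √2 * π := by
  rw [← integral_comp_polarCoord_symm]
  have h1 : ∀ p : ℝ × ℝ, p.1 • (4 * √2 / ((1 + (polarCoord.symm p).1 ^ 2
      + (polarCoord.symm p).2 ^ 2) * √(1 + (polarCoord.symm p).1 ^ 2
      + (polarCoord.symm p).2 ^ 2)))
      = (fun r : ℝ => 4 * √2 * (r / ((1 + r ^ 2) * √(1 + r ^ 2)))) p.1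
        * (fun _ : ℝ => (1 : ℝ)) p.2 := by
    intro p
    have : 1 + (p.1 * cos p.2) ^ 2 + (p.1 * sin p.2) ^ 2 = 1 + p.1 ^ 2 := by
      nlinarith [sin_sq_add_cos_sq p.2]
    simp only [polarCoord_symm_apply, this, smul_eq_mul]
    ring
  simp_rw [h1]
  rw [polarCoord_target, Measure.volume_eq_prod,
    setIntegral_prod_mul (fun r : ℝ => 4 * √2 * (r / ((1 + r ^ 2) * √(1 + r ^ 2))))
      (fun _ : ℝ => (1 : ℝ))]
  have h2 : ∫ r in Set.Ioi (0 : ℝ), 4 * √2 * (r / ((1 + r ^ 2) * √(1 + r ^ 2)))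
      = 0 - (-(4 * √2) * (√(1 + (0 : ℝ) ^ 2))⁻¹) := by
    apply integral_Ioi_of_hasDerivAt_of_nonneg'
      (g := fun r : ℝ => -(4 * √2) * (√(1 + r ^ 2))⁻¹)
    · intro r _
      have hp : (0 : ℝ) < 1 + r ^ 2 := by positivity
      have hs : 0 < √(1 + r ^ 2) := sqrt_pos.2 hp
      have hd : HasDerivAt (fun r : ℝ => 1 + r ^ 2) (2 * r) r := by
        simpa using (hasDerivAt_pow 2 r).const_add 1
      have := ((hd.sqrt hp.ne').inv hs.ne').const_mul (-(4 * √2))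
      refine HasDerivAt.congr_deriv this ?_
      rw [sq_sqrt hp.le]
      field_simp
    · intro r hr
      have : (0 : ℝ) < r := hr
      positivity
    · have : Filter.Tendsto (fun r : ℝ => √(1 + r ^ 2)) Filter.atTop Filter.atTop := by
        apply Real.tendsto_sqrt_atTop.comp
        apply Filter.tendsto_atTop_add_const_left
        exact Filter.tendsto_pow_atTop (by norm_num)
      simpa using (this.inv_tendsto_atTop).const_mul (-(4 * √2))
  rw [h2]
  simp
  rw [max_eq_left (by positivity)]
  ring

lemma bp_g_integrable :
    Integrable fun x : ℝ × ℝ =>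
      4 * √2 / ((1 + x.1 ^ 2 + x.2 ^ 2) * √(1 + x.1 ^ 2 + x.2 ^ 2)) := by
  by_contra h
  have := integral_undef h
  rw [bp_g_polar] at this
  have : 0 < 8 * √2 * π := by positivity
  linarith

lemma bp_diff (x : ℝ × ℝ) (R : Matrix (Fin 3) (Fin 3) ℝ) :
    DifferentiableAt ℝ (fun y => R.mulVec (BP y)) x := by
  rw [differentiableAt_pi]
  intro i
  have hp : (1 : ℝ) + x.1 ^ 2 + x.2 ^ 2 ≠ 0 := by positivity
  simp only [Matrix.mulVec, dotProduct, Fin.sum_univ_three, BP]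
  simp
  fun_prop (disch := assumption)

lemma bp_pd1 (x : ℝ × ℝ) (R : Matrix (Fin 3) (Fin 3) ℝ) :
    pd1 (fun y => R.mulVec (BP y)) x 2 =
      (R 2 0 * (-2 + 2 * x.1 ^ 2 - 2 * x.2 ^ 2) + R 2 1 * (4 * x.1 * x.2)
        + R 2 2 * (-4 * x.1)) / (1 + x.1 ^ 2 + x.2 ^ 2) ^ 2 := by
  have hp : (1 : ℝ) + x.1 ^ 2 + x.2 ^ 2 ≠ 0 := by positivity
  have hl : HasDerivAt (fun t : ℝ => (t, x.2)) ((1 : ℝ), (0 : ℝ)) x.1 :=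
    (hasDerivAt_id x.1).prodMk (hasDerivAt_const x.1 x.2)
  have h1 := (hasDerivAt_pi.1 ((bp_diff x R).hasFDerivAt.comp_hasDerivAt x.1 hl)) 2
  refine h1.unique ?_
  have hD : HasDerivAt (fun t : ℝ => 1 + t ^ 2 + x.2 ^ 2) (2 * x.1) x.1 := by
    simpa using ((hasDerivAt_pow 2 x.1).const_add 1).add_const (x.2 ^ 2)
  have hS : HasDerivAt (fun t : ℝ => 1 - (t ^ 2 + x.2 ^ 2)) (-(2 * x.1)) x.1 := by
    simpa using ((hasDerivAt_pow 2 x.1).add_const (x.2 ^ 2)).const_sub 1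
  have a0 := (((hasDerivAt_id x.1).const_mul (-2)).div hD hp).const_mul (R 2 0)
  have a1 := ((hasDerivAt_const x.1 (-2 * x.2)).div hD hp).const_mul (R 2 1)
  have a2 := (hS.div hD hp).const_mul (R 2 2)
  convert (a0.add a1).add a2 using 1
  · funext t
    simp [Matrix.mulVec, dotProduct, Fin.sum_univ_three, BP]
  · simp
    field_simp
    ring

lemma bp_pd2 (x : ℝ × ℝ) (R : Matrix (Fin 3) (Fin 3) ℝ) :
    pd2 (fun y => R.mulVec (BP y)) x 2 =
      (R 2 0 * (4 * x.1 * x.2) + R 2 1 * (-2 + 2 * x.2 ^ 2 - 2 * x.1 ^ 2)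
        + R 2 2 * (-4 * x.2)) / (1 + x.1 ^ 2 + x.2 ^ 2) ^ 2 := by
  have hp : (1 : ℝ) + x.1 ^ 2 + x.2 ^ 2 ≠ 0 := by positivity
  have hl : HasDerivAt (fun t : ℝ => (x.1, t)) ((0 : ℝ), (1 : ℝ)) x.2 :=
    (hasDerivAt_const x.2 x.1).prodMk (hasDerivAt_id x.2)
  have h1 := (hasDerivAt_pi.1 ((bp_diff x R).hasFDerivAt.comp_hasDerivAt x.2 hl)) 2
  refine h1.unique ?_
  have hD : HasDerivAt (fun t : ℝ => 1 + x.1 ^ 2 + t ^ 2) (2 * x.2) x.2 := by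
    simpa using (hasDerivAt_pow 2 x.2).const_add (1 + x.1 ^ 2)
  have hS : HasDerivAt (fun t : ℝ => 1 - (x.1 ^ 2 + t ^ 2)) (-(2 * x.2)) x.2 := by
    simpa using ((hasDerivAt_pow 2 x.2).const_add (x.1 ^ 2)).const_sub 1
  have a1 := (((hasDerivAt_id x.2).const_mul (-2)).div hD hp).const_mul (R 2 1)
  have a0 := ((hasDerivAt_const x.2 (-2 * x.1)).div hD hp).const_mul (R 2 0)
  have a2 := (hS.div hD hp).const_mul (R 2 2)
  convert (a0.add a1).add a2 using 1
  · funext t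
    simp [Matrix.mulVec, dotProduct, Fin.sum_univ_three, BP]
  · simp
    field_simp
    ring

/-- Cauchy–Schwarz in three variables. -/
lemma bp_cs3 (a b c u v w : ℝ) :
    (a * u + b * v + c * w) ^ 2 ≤ (a ^ 2 + b ^ 2 + c ^ 2) * (u ^ 2 + v ^ 2 + w ^ 2) := by
  nlinarith [sq_nonneg (a * v - b * u), sq_nonneg (a * w - c * u), sq_nonneg (b * w - c * v)]

open Matrix in
lemma bp_normsq (R : Matrix (Fin 3) (Fin 3) ℝ) (hR : R * Rᵀ = 1) (v : Fin 3 → ℝ) :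
    (R.mulVec v 0) ^ 2 + (R.mulVec v 1) ^ 2 ≤ v 0 ^ 2 + v 1 ^ 2 + v 2 ^ 2 := by
  have hR' : Rᵀ * R = 1 := mul_eq_one_comm.1 hR
  have h : R.mulVec v ⬝ᵥ R.mulVec v = v ⬝ᵥ v := by
    rw [Matrix.dotProduct_mulVec, Matrix.vecMul_mulVec, ← Matrix.mulVec_transpose]
    simp [hR']
  simp only [dotProduct, Fin.sum_univ_three] at h
  nlinarith [sq_nonneg (R.mulVec v 2)]

open Matrix in
lemma bp_row (R : Matrix (Fin 3) (Fin 3) ℝ) (hR : R * Rᵀ = 1) :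
    R 2 0 ^ 2 + R 2 1 ^ 2 + R 2 2 ^ 2 = 1 := by
  have h := congrFun (congrFun hR 2) 2
  simp [Matrix.mul_apply, Fin.sum_univ_three] at h
  linarith

open Matrix in
lemma bp_pointwise (R : Matrix (Fin 3) (Fin 3) ℝ) (hR : R * Rᵀ = 1) (x : ℝ × ℝ) :
    |(R.mulVec (BP x + e3)) 0 * pd1 (fun y => R.mulVec (BP y)) x 2
            + (R.mulVec (BP x + e3)) 1 * pd2 (fun y => R.mulVec (BP y)) x 2|
      ≤ 4 * √2 / ((1 + x.1 ^ 2 + x.2 ^ 2) * √(1 + x.1 ^ 2 + x.2 ^ 2)) := by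
  have hp : (0 : ℝ) < 1 + x.1 ^ 2 + x.2 ^ 2 := by positivity
  apply abs_le_of_sq_le_sq _ (by positivity)
  have hA : (R.mulVec (BP x + e3) 0) ^ 2 + (R.mulVec (BP x + e3) 1) ^ 2
      ≤ 4 / (1 + x.1 ^ 2 + x.2 ^ 2) := by
    refine (bp_normsq R hR _).trans (le_of_eq ?_)
    simp [BP, e3]
    field_simp
    ring
  have hr := bp_row R hR
  have hP : (pd1 (fun y => R.mulVec (BP y)) x 2) ^ 2 ≤ 4 / (1 + x.1 ^ 2 + x.2 ^ 2) ^ 2 := by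
    rw [bp_pd1, div_pow]
    rw [div_le_div_iff₀ (by positivity) (by positivity)]
    have := bp_cs3 (R 2 0) (R 2 1) (R 2 2) (-2 + 2 * x.1 ^ 2 - 2 * x.2 ^ 2)
      (4 * x.1 * x.2) (-4 * x.1)
    rw [hr] at this
    calc _ ≤ _ := mul_le_mul_of_nonneg_right this (by positivity)
      _ = _ := by ring
  have hQ : (pd2 (fun y => R.mulVec (BP y)) x 2) ^ 2 ≤ 4 / (1 + x.1 ^ 2 + x.2 ^ 2) ^ 2 := by
    rw [bp_pd2, div_pow]
    rw [div_le_div_iff₀ (by positivity) (by positivity)]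
    have := bp_cs3 (R 2 0) (R 2 1) (R 2 2) (4 * x.1 * x.2)
      (-2 + 2 * x.2 ^ 2 - 2 * x.1 ^ 2) (-4 * x.2)
    rw [hr] at this
    calc _ ≤ _ := mul_le_mul_of_nonneg_right this (by positivity)
      _ = _ := by ring
  generalize pd1 (fun y => R.mulVec (BP y)) x 2 = p at *
  generalize pd2 (fun y => R.mulVec (BP y)) x 2 = q at *
  generalize R.mulVec (BP x + e3) 0 = a at *
  generalize R.mulVec (BP x + e3) 1 = b at *
  calc (a * p + b * q) ^ 2 ≤ (a ^ 2 + b ^ 2) * (p ^ 2 + q ^ 2) := by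
        nlinarith [sq_nonneg (a * q - b * p)]
    _ ≤ (4 / (1 + x.1 ^ 2 + x.2 ^ 2)) * (4 / (1 + x.1 ^ 2 + x.2 ^ 2) ^ 2
          + 4 / (1 + x.1 ^ 2 + x.2 ^ 2) ^ 2) := by gcongr
    _ = _ := by
      rw [div_pow, mul_pow, mul_pow, sq_sqrt hp.le, sq_sqrt (by norm_num)]
      field_simp
      ring

open Matrix in
/-- there is a universal constant `C > 0` (one may take `C = 8√2 π`)
with `∫_{ℝ²} |(R(Φ+e₃))'·∇(RΦ)₃| dx ≤ C` for every `R ∈ SO(3)`; in particular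
`|∫_{ℝ²} (R(Φ+e₃))'·∇(RΦ)₃ dx| ≤ C`. -/
theorem BP_dmi_uniform_bound :
    ∃ C > (0 : ℝ), C = 8 * Real.sqrt 2 * π ∧
      ∀ R : Matrix (Fin 3) (Fin 3) ℝ, R * Rᵀ = 1 → R.det = 1 →
      ((∫ x : ℝ × ℝ,
          |(R.mulVec (BP x + e3)) 0 * pd1 (fun y => R.mulVec (BP y)) x 2
            + (R.mulVec (BP x + e3)) 1 * pd2 (fun y => R.mulVec (BP y)) x 2|) ≤ C ∧
        |∫ x : ℝ × ℝ,
          ((R.mulVec (BP x + e3)) 0 * pd1 (fun y => R.mulVec (BP y)) x 2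
            + (R.mulVec (BP x + e3)) 1 * pd2 (fun y => R.mulVec (BP y)) x 2)| ≤ C) := by
  refine ⟨8 * √2 * π, by positivity, rfl, fun R hR _ => ?_⟩
  have key := integral_mono_of_nonneg (μ := (volume : Measure (ℝ × ℝ)))
    (Filter.Eventually.of_forall fun x => abs_nonneg _) bp_g_integrable
    (Filter.Eventually.of_forall (bp_pointwise R hR))
  rw [bp_g_polar] at key
  exact ⟨key, (abs_integral_le_integral_abs).trans key⟩


end
end

section
/- Let m : ℝ² → ℝ³ be a Lipschitz map with |m(x)| = 1 for all x and m = −e₃ outside some compact set. Then ∫_{ℝ²} |∇m|² dx ≥ 8π |N(m)|. -/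
open MeasureTheory Real

noncomputable section

theorem density_bound (a b c d e f p q r : ℝ) (h : a ^ 2 + b ^ 2 + c ^ 2 = 1) :
    |a * (e * r - f * q) + b * (f * p - d * r) + c * (d * q - e * p)| * 2
      ≤ (d ^ 2 + e ^ 2 + f ^ 2) + (p ^ 2 + q ^ 2 + r ^ 2) := by
  set X := e * r - f * q
  set Y := f * p - d * r
  set Z := d * q - e * p
  set A := d ^ 2 + e ^ 2 + f ^ 2 with hA
  set B := p ^ 2 + q ^ 2 + r ^ 2 with hB
  have hAB : 0 ≤ A + B := by positivity
  have h1 : (a * X + b * Y + c * Z) ^ 2 ≤ X ^ 2 + Y ^ 2 + Z ^ 2 := by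
    have : (a * X + b * Y + c * Z) ^ 2 ≤ (a ^ 2 + b ^ 2 + c ^ 2) * (X ^ 2 + Y ^ 2 + Z ^ 2) := by
      nlinarith [sq_nonneg (a * Y - b * X), sq_nonneg (a * Z - c * X), sq_nonneg (b * Z - c * Y)]
    rwa [h, one_mul] at this
  have h2 : X ^ 2 + Y ^ 2 + Z ^ 2 = A * B - (d * p + e * q + f * r) ^ 2 := by
    simp only [X, Y, Z, A, B]; ring
  have h3 : ((a * X + b * Y + c * Z) * 2) ^ 2 ≤ (A + B) ^ 2 := by
    nlinarith [sq_nonneg (A - B), sq_nonneg (d * p + e * q + f * r)]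
  have h4 := abs_le_of_sq_le_sq h3 hAB
  have h5 : |(a * X + b * Y + c * Z) * 2| ≤ A + B := h4
  rwa [abs_mul, abs_two] at h5

theorem pd_bound (m : ℝ × ℝ → Fin 3 → ℝ) (K : NNReal) (hK : LipschitzWith K m) (x v : ℝ × ℝ)
    (hv : ‖v‖ ≤ 1) (j : Fin 3) : (fderiv ℝ m x v j) ^ 2 ≤ (K : ℝ) ^ 2 := by
  have h1 : ‖fderiv ℝ m x v j‖ ≤ K := by
    calc ‖fderiv ℝ m x v j‖ ≤ ‖fderiv ℝ m x v‖ := norm_le_pi_norm _ j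
      _ ≤ ‖fderiv ℝ m x‖ * ‖v‖ := ContinuousLinearMap.le_opNorm _ _
      _ ≤ K * 1 := by
          gcongr
          exact norm_fderiv_le_of_lipschitz ℝ hK
      _ = K := mul_one _
  rw [← sq_abs]
  exact pow_le_pow_left₀ (abs_nonneg _) h1 2

theorem gradSq_integrable (m : ℝ × ℝ → Fin 3 → ℝ)
    (hLip : ∃ K, LipschitzWith K m)
    (hCpt : ∃ s : Set (ℝ × ℝ), IsCompact s ∧ ∀ x ∉ s, m x = -e3) :
    Integrable (gradSq m) := by
  obtain ⟨K, hK⟩ := hLip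
  obtain ⟨s, hs, hm⟩ := hCpt
  have hmeas : Measurable (gradSq m) := by
    have h1 : ∀ (v : ℝ × ℝ) (j : Fin 3), Measurable fun x => (fderiv ℝ m x v j) ^ 2 := fun v j =>
      ((measurable_pi_apply j).comp (measurable_fderiv_apply_const ℝ m v)).pow_const 2
    unfold gradSq pd1 pd2
    exact (Finset.measurable_sum _ fun j _ => h1 _ j).add
      (Finset.measurable_sum _ fun j _ => h1 _ j)
  have hsupp : Function.support (gradSq m) ⊆ s := by
    intro x hx
    by_contra hxs
    apply hx
    have hev : m =ᶠ[nhds x] fun _ => -e3 := by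
      filter_upwards [hs.isClosed.isOpen_compl.mem_nhds hxs] with y hy using hm y hy
    have : fderiv ℝ m x = 0 := by
      rw [hev.fderiv_eq]; simp
    simp [gradSq, pd1, pd2, this]
  rw [← integrableOn_iff_integrable_of_support_subset hsupp]
  refine Measure.integrableOn_of_bounded (M := 6 * (K : ℝ) ^ 2) hs.measure_lt_top.ne
    hmeas.aestronglyMeasurable (Filter.Eventually.of_forall fun x => ?_)
  have hv1 : ‖((1 : ℝ), (0 : ℝ))‖ ≤ 1 := by simp [Prod.norm_def]
  have hv2 : ‖((0 : ℝ), (1 : ℝ))‖ ≤ 1 := by simp [Prod.norm_def]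
  have b1 := pd_bound m K hK x _ hv1
  have b2 := pd_bound m K hK x _ hv2
  have h0 : 0 ≤ gradSq m x := by unfold gradSq; positivity
  rw [Real.norm_of_nonneg h0]
  simp only [gradSq, pd1, pd2, Fin.sum_univ_three]
  linarith [b1 0, b1 1, b1 2, b2 0, b2 1, b2 2]

/-- the sharp topological lower bound: for a Lipschitz sphere-valued
map `m` equal to `−e₃` outside a compact set, `∫_{ℝ²}|∇m|² dx ≥ 8π|N(m)|`. -/
theorem topological_lower_bound (m : ℝ × ℝ → Fin 3 → ℝ)
    (hLip : ∃ K, LipschitzWith K m)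
    (hUnit : ∀ x, (∑ i, (m x i) ^ 2) = 1)
    (hCpt : ∃ s : Set (ℝ × ℝ), IsCompact s ∧ ∀ x ∉ s, m x = -e3) :
    8 * π * |degree m| ≤ ∫ x : ℝ × ℝ, gradSq m x := by
  have hint := gradSq_integrable m hLip hCpt
  have hb : ‖∫ x : ℝ × ℝ, ∑ i, m x i * cross3 (pd1 m x) (pd2 m x) i‖
      ≤ ∫ x : ℝ × ℝ, gradSq m x / 2 := by
    refine norm_integral_le_of_norm_le (hint.div_const 2) (Filter.Eventually.of_forall fun x => ?_)
    have hu := hUnit x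
    rw [Fin.sum_univ_three] at hu
    have := density_bound _ _ _ (pd1 m x 0) (pd1 m x 1) (pd1 m x 2)
      (pd2 m x 0) (pd2 m x 1) (pd2 m x 2) hu
    rw [Real.norm_eq_abs, le_div_iff₀ two_pos]
    simpa [gradSq, cross3, Fin.sum_univ_three] using this
  rw [integral_div, Real.norm_eq_abs] at hb
  have hpi := Real.pi_pos
  rw [degree, abs_mul, abs_of_pos (by positivity : (0 : ℝ) < 1 / (4 * π))]
  have e : ∀ t : ℝ, 8 * π * (1 / (4 * π) * t) = 2 * t := fun t => by field_simp; ring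
  rw [e]
  linarith

end
end

section
/- Identify ℝ² with ℂ. Let Ω ⊂ ℂ be a bounded open set whose boundary ∂Ω is the image of an injective C¹ closed curve with nonvanishing derivative, positively oriented with respect to Ω, let z₀ ∈ Ω, and let f, g be holomorphic on an open neighborhood of the closure of Ω. Suppose u : ℂ → ℂ is continuous, u(z) = f(z) + conj(g(z)) for z in the closure of Ω, and u(z) = 2/(conj(z) − conj(z₀)) for z ∈ ℂ \ Ω. Then ∫_{ℝ²} (|∇Re u|² + |∇Im u|²) dx = 8π f′(z₀); in particular f′(z₀) is a nonnegative real number. -/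
open MeasureTheory Real Complex

noncomputable section

/-- The Dirichlet energy `D(u) = ∫_{ℝ²} (|∇Re u|² + |∇Im u|²) dx` of a map
`u : ℂ → ℂ`, with `ℝ²` identified with `ℂ` (Lebesgue measure). -/
def dirE (u : ℂ → ℂ) : ℝ :=
  ∫ z : ℂ, (‖fderiv ℝ (fun w => (u w).re) z‖ ^ 2 + ‖fderiv ℝ (fun w => (u w).im) z‖ ^ 2)


lemma null_curve (γ : ℝ → ℂ) (hC1 : ContDiff ℝ 1 γ) (s : Set ℝ) : volume (γ '' s) = 0 := by
  have h : ∀ z ∈ (Set.univ : Set ℂ), HasFDerivWithinAt (fun z : ℂ => γ z.re)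
      ((fderiv ℝ γ z.re).comp reCLM) Set.univ z := by
    intro z _
    have h1 : HasFDerivAt γ (fderiv ℝ γ z.re) (reCLM z) :=
      ((hC1.differentiable (by simp)) z.re).hasFDerivAt
    exact (h1.comp z reCLM.hasFDerivAt).hasFDerivWithinAt
  have := addHaar_image_eq_zero_of_det_fderivWithin_eq_zero volume h (by
    intro z _
    by_contra hne
    have hinj : Function.Injective (((fderiv ℝ γ z.re).comp reCLM : ℂ →L[ℝ] ℂ) : ℂ →ₗ[ℝ] ℂ) := by
      rw [← LinearMap.ker_eq_bot]
      by_contra hk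
      exact hne (LinearMap.det_eq_zero_iff_ker_ne_bot.2 hk)
    have : (Complex.I) = 0 := hinj (by simp)
    exact Complex.I_ne_zero this)
  refine measure_mono_null ?_ this
  rintro _ ⟨t, _, rfl⟩
  exact ⟨(t : ℂ), trivial, by simp⟩

lemma exists_frontier_segment {Ω : Set ℂ} {a b : ℂ} (ha : a ∈ Ω) (hb : b ∉ Ω) :
    ∃ c ∈ segment ℝ a b, c ∈ frontier Ω := by
  have := (convex_segment (𝕜 := ℝ) a b).isPreconnected
  by_contra! h
  have h1 := this.subset_left_of_subset_union (u := interior Ω) (v := (closure Ω)ᶜ) isOpen_interior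
    isClosed_closure.isOpen_compl ?_ ?_ ?_
  · exact hb (interior_subset (h1 (right_mem_segment ℝ a b)))
  · rw [Set.disjoint_compl_right_iff_subset]
    exact interior_subset.trans subset_closure
  · intro c hc
    by_contra hh
    apply h c hc
    simp only [Set.mem_union, Set.mem_compl_iff, not_or, not_not] at hh
    exact ⟨hh.2, hh.1⟩
  · refine ⟨a, left_mem_segment ℝ a b, ?_⟩
    by_contra hh
    exact h a (left_mem_segment ℝ a b) ⟨subset_closure ha, hh⟩

lemma lip_ext {Ω : Set ℂ} {F : ℂ → ℝ} {C : NNReal} (hF : LipschitzWith C F)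
    (h0 : ∀ z ∈ frontier Ω, F z = 0) : LipschitzWith C (Ω.indicator F) := by
  have key : ∀ a b, a ∈ Ω → b ∉ Ω → dist (F a) 0 ≤ C * dist a b := by
    intro a b ha hb
    obtain ⟨c, hc, hcf⟩ := exists_frontier_segment ha hb
    rw [← h0 c hcf]
    refine (hF.dist_le_mul a c).trans ?_
    gcongr
    rw [segment_eq_image_lineMap] at hc
    obtain ⟨t, ht, rfl⟩ := hc
    rw [dist_left_lineMap]
    rw [Real.norm_of_nonneg ht.1]
    nlinarith [ht.2, dist_nonneg (x := a) (y := b)]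
  refine LipschitzWith.of_dist_le_mul fun a b => ?_
  by_cases ha : a ∈ Ω <;> by_cases hb : b ∈ Ω
  · simpa [ha, hb] using hF.dist_le_mul a b
  · simpa only [Set.indicator, ha, hb, if_true, if_false] using key a b ha hb
  · simpa only [Set.indicator, ha, hb, if_true, if_false, dist_comm] using key b a hb ha
  · simp [ha, hb]; positivity

lemma cutoff {Ω U : Set ℂ} (hΩb : Bornology.IsBounded Ω) (hU : IsOpen U) (hUc : closure Ω ⊆ U)
    {F : ℂ → ℝ} (hF : ContDiffOn ℝ 1 F U) :
    ∃ G : ℂ → ℝ, (∃ C, LipschitzWith C G) ∧ (∀ z ∈ closure Ω, G z = F z) := by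
  obtain ⟨R, hR⟩ := hΩb.closure.subset_ball (0:ℂ)
  obtain ⟨χ, h0, h1, -⟩ := exists_contMDiffMap_zero_one_nhds_of_isClosed (n := 1) (modelWithCornersSelf ℝ ℂ)
    (s := (U ∩ Metric.ball 0 R)ᶜ) (t := closure Ω) (hU.inter Metric.isOpen_ball).isClosed_compl
    isClosed_closure (by
      rw [Set.disjoint_left]; intro x hx hx'; exact hx ⟨hUc hx', hR hx'⟩)
  have hχ : ContDiff ℝ 1 (χ : ℂ → ℝ) := χ.contMDiff.contDiff
  refine ⟨fun z => χ z * F z, ?_, ?_⟩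
  · refine ContDiff.lipschitzWith_of_hasCompactSupport (𝕂 := ℝ) (n := 1) ?_ ?_ (by simp)
    · refine HasCompactSupport.intro (isCompact_closedBall (0:ℂ) R) ?_
      intro x hx
      have : x ∈ (U ∩ Metric.ball 0 R)ᶜ := fun h => hx (Metric.ball_subset_closedBall h.2)
      simp [(h0.filter_mono (nhds_le_nhdsSet this)).self_of_nhds]
    · rw [contDiff_iff_contDiffAt]
      intro x
      by_cases hx : x ∈ U ∩ Metric.ball 0 R
      · exact hχ.contDiffAt.mul (hF.contDiffAt (hU.mem_nhds hx.1))
      · have := h0.filter_mono (nhds_le_nhdsSet hx)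
        refine (contDiffAt_const (c := (0:ℝ))).congr_of_eventuallyEq ?_
        filter_upwards [this] with y hy
        simp [hy]
  · intro z hz
    simp [(h1.filter_mono (nhds_le_nhdsSet hz)).self_of_nhds]

lemma green_real {Ω U : Set ℂ} (hΩo : IsOpen Ω) (hΩb : Bornology.IsBounded Ω)
    (hΩf : volume (frontier Ω) = 0) (hU : IsOpen U) (hUc : closure Ω ⊆ U)
    {F : ℂ → ℝ} (hF : ContDiffOn ℝ 1 F U) (h0 : ∀ z ∈ frontier Ω, F z = 0) (v : ℂ) :
    ∫ z in Ω, fderiv ℝ F z v = 0 := by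
  obtain ⟨G, ⟨C, hG⟩, hGF⟩ := cutoff hΩb hU hUc hF
  have hL := lip_ext (Ω := Ω) hG (fun z hz => by rw [hGF z (frontier_subset_closure hz), h0 z hz])
  have hcs : HasCompactSupport (Ω.indicator G) :=
    HasCompactSupport.intro hΩb.isCompact_closure (fun x hx => by
      rw [Set.indicator_of_notMem (fun h => hx (subset_closure h))])
  have h := (LipschitzWith.const (α := ℂ) (1:ℝ)).integral_lineDeriv_mul_eq (μ := volume) hL hcs (-v)
  have hc : ∀ (x w : ℂ), lineDeriv ℝ (fun _ : ℂ => (1:ℝ)) x w = 0 := fun x w => by simp [lineDeriv]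
  simp only [hc, zero_mul, integral_zero, mul_one, neg_neg] at h
  rw [show (0:ℝ) = _ from h, ← integral_indicator hΩo.measurableSet]
  symm
  refine integral_congr_ae ?_
  have hae : ∀ᵐ z : ℂ, z ∉ frontier Ω := by
    rw [ae_iff]; simpa using hΩf
  filter_upwards [hae] with z hz
  by_cases hzΩ : z ∈ Ω
  · rw [Set.indicator_of_mem hzΩ]
    have e : Ω.indicator G =ᶠ[nhds z] F := by
      filter_upwards [hΩo.mem_nhds hzΩ] with y hy
      rw [Set.indicator_of_mem hy, hGF y (subset_closure hy)]
    rw [e.lineDeriv_eq]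
    rw [DifferentiableAt.lineDeriv_eq_fderiv]
    exact (hF.contDiffAt (hU.mem_nhds (hUc (subset_closure hzΩ)))).differentiableAt (by simp)
  · rw [Set.indicator_of_notMem hzΩ]
    have hzc : z ∈ (closure Ω)ᶜ := fun hc => hz ⟨hc, by rwa [hΩo.interior_eq]⟩
    have e : Ω.indicator G =ᶠ[nhds z] fun _ => 0 := by
      filter_upwards [isClosed_closure.isOpen_compl.mem_nhds hzc] with y hy
      rw [Set.indicator_of_notMem (fun h => hy (subset_closure h))]
    rw [e.lineDeriv_eq]
    simp [lineDeriv]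

lemma integrableOn_fderiv {Ω U : Set ℂ} (hΩb : Bornology.IsBounded Ω) 
    (hUc : closure Ω ⊆ U) {E : Type*} [NormedAddCommGroup E] [NormedSpace ℝ E]
    {F : ℂ → E} (hF : ContinuousOn F U) : IntegrableOn F Ω :=
  ((hF.mono hUc).integrableOn_compact hΩb.isCompact_closure).mono_set subset_closure

lemma contOn_fderiv {U : Set ℂ} (hU : IsOpen U) {E : Type*} [NormedAddCommGroup E]
    [NormedSpace ℝ E] {F : ℂ → E} (hF : ContDiffOn ℝ 1 F U) (v : ℂ) :
    ContinuousOn (fun z => fderiv ℝ F z v) U :=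
  (hF.continuousOn_fderiv_of_isOpen hU (by simp)).clm_apply continuousOn_const

lemma green_cplx {Ω U : Set ℂ} (hΩo : IsOpen Ω) (hΩb : Bornology.IsBounded Ω)
    (hΩf : volume (frontier Ω) = 0) (hU : IsOpen U) (hUc : closure Ω ⊆ U)
    {F : ℂ → ℂ} (hF : ContDiffOn ℝ 1 F U) (h0 : ∀ z ∈ frontier Ω, F z = 0) (v : ℂ) :
    ∫ z in Ω, fderiv ℝ F z v = 0 := by
  have hint := integrableOn_fderiv hΩb hUc (contOn_fderiv hU hF v)
  have hd : ∀ z ∈ Ω, DifferentiableAt ℝ F z := fun z hz =>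
    (hF.contDiffAt (hU.mem_nhds (hUc (subset_closure hz)))).differentiableAt (by simp)
  have hre := green_real hΩo hΩb hΩf hU hUc (F := fun z => (F z).re)
    (reCLM.contDiff.comp_contDiffOn hF) (fun z hz => by simp [h0 z hz]) v
  have him := green_real hΩo hΩb hΩf hU hUc (F := fun z => (F z).im)
    (imCLM.contDiff.comp_contDiffOn hF) (fun z hz => by simp [h0 z hz]) v
  apply Complex.ext
  · have := reCLM.integral_comp_comm hint
    rw [← reCLM_apply, ← this, Complex.zero_re, ← hre]
    refine setIntegral_congr_fun hΩo.measurableSet fun z hz => ?_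
    have := (reCLM.hasFDerivAt.comp z (hd z hz).hasFDerivAt).fderiv
    simp only [Function.comp_def, reCLM_apply] at this
    simp [this]
  · have := imCLM.integral_comp_comm hint
    rw [← imCLM_apply, ← this, Complex.zero_im, ← him]
    refine setIntegral_congr_fun hΩo.measurableSet fun z hz => ?_
    have := (imCLM.hasFDerivAt.comp z (hd z hz).hasFDerivAt).fderiv
    simp only [Function.comp_def, imCLM_apply] at this
    simp [this]

/-- Twice the Wirtinger derivative. -/
noncomputable def wD (p : ℂ → ℂ) (z : ℂ) : ℂ := fderiv ℝ p z 1 - I * fderiv ℝ p z I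

/-- The Jacobian. -/
noncomputable def jac (p : ℂ → ℂ) (z : ℂ) : ℝ :=
  (starRingEnd ℂ (fderiv ℝ p z 1) * fderiv ℝ p z I).im

lemma contOn_wD {U : Set ℂ} (hU : IsOpen U) {p : ℂ → ℂ} (hp : ContDiffOn ℝ 1 p U) :
    ContinuousOn (wD p) U :=
  (contOn_fderiv hU hp 1).sub (continuousOn_const.mul (contOn_fderiv hU hp I))

lemma contOn_jac {U : Set ℂ} (hU : IsOpen U) {p : ℂ → ℂ} (hp : ContDiffOn ℝ 1 p U) :
    ContinuousOn (jac p) U :=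
  continuous_im.comp_continuousOn
    ((continuous_conj.comp_continuousOn (contOn_fderiv hU hp 1)).mul (contOn_fderiv hU hp I))

lemma holo_real {U : Set ℂ} (hU : IsOpen U) {h : ℂ → ℂ} (hh : DifferentiableOn ℂ h U)
    {n : WithTop ℕ∞} : ContDiffOn ℝ n h U :=
  (hh.contDiffOn hU).restrict_scalars ℝ

lemma lemma_M {Ω U : Set ℂ} (hΩo : IsOpen Ω) (hΩb : Bornology.IsBounded Ω)
    (hΩf : volume (frontier Ω) = 0) (hU : IsOpen U) (hUc : closure Ω ⊆ U)
    {h p q : ℂ → ℂ} (hh : DifferentiableOn ℂ h U) (hp : ContDiffOn ℝ 1 p U)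
    (hq : ContDiffOn ℝ 1 q U) (h0 : ∀ z ∈ frontier Ω, p z = q z) :
    ∫ z in Ω, h z * starRingEnd ℂ (wD p z) = ∫ z in Ω, h z * starRingEnd ℂ (wD q z) := by
  have hF : ContDiffOn ℝ 1 (fun z => h z * starRingEnd ℂ (p z - q z)) U :=
    (holo_real hU hh).mul (conjCLE.contDiff.comp_contDiffOn (hp.sub hq))
  have hz : ∀ z ∈ frontier Ω, h z * starRingEnd ℂ (p z - q z) = 0 := by
    intro z hz; simp [h0 z hz]
  have e1 := green_cplx hΩo hΩb hΩf hU hUc hF hz 1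
  have e2 := green_cplx hΩo hΩb hΩf hU hUc hF hz I
  have i1 := integrableOn_fderiv hΩb hUc (contOn_fderiv hU hF 1)
  have i2 := integrableOn_fderiv hΩb hUc (contOn_fderiv hU hF I)
  have ip : IntegrableOn (fun z => h z * starRingEnd ℂ (wD p z)) Ω :=
    integrableOn_fderiv hΩb hUc
      (hh.continuousOn.mul (continuous_conj.comp_continuousOn (contOn_wD hU hp)))
  have iq : IntegrableOn (fun z => h z * starRingEnd ℂ (wD q z)) Ω :=
    integrableOn_fderiv hΩb hUc
      (hh.continuousOn.mul (continuous_conj.comp_continuousOn (contOn_wD hU hq)))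
  rw [← sub_eq_zero, ← integral_sub ip iq]
  have : (0 : ℂ) = ∫ z in Ω, (fderiv ℝ (fun z => h z * starRingEnd ℂ (p z - q z)) z 1
      + I * fderiv ℝ (fun z => h z * starRingEnd ℂ (p z - q z)) z I) := by
    rw [integral_add i1 (i2.const_mul I), integral_const_mul, e1, e2]; simp
  rw [this]
  refine setIntegral_congr_fun hΩo.measurableSet fun z hz => ?_
  have hzU := hU.mem_nhds (hUc (subset_closure hz))
  have dh : HasFDerivAt h ((ContinuousLinearMap.toSpanSingleton ℂ (deriv h z)).restrictScalars ℝ) z :=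
    ((hh.differentiableAt hzU).hasDerivAt.hasFDerivAt).restrictScalars ℝ
  have dp := ((hp.contDiffAt hzU).differentiableAt (by simp)).hasFDerivAt
  have dq := ((hq.contDiffAt hzU).differentiableAt (by simp)).hasFDerivAt
  have dc : HasFDerivAt (fun z => starRingEnd ℂ (p z - q z)) _ z :=
    conjCLE.toContinuousLinearMap.hasFDerivAt.comp z (dp.sub dq)
  have dF : HasFDerivAt (fun z => h z * starRingEnd ℂ (p z - q z)) _ z := dh.mul dc
  simp only [wD]
  rw [dF.fderiv]
  simp
  ring_nf
  simp
  ring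

lemma lemma_N {Ω U : Set ℂ} (hΩo : IsOpen Ω) (hΩb : Bornology.IsBounded Ω)
    (hΩf : volume (frontier Ω) = 0) (hU : IsOpen U) (hUc : closure Ω ⊆ U)
    {p q : ℂ → ℂ} (hp : ContDiffOn ℝ 2 p U)
    (hq : ContDiffOn ℝ 2 q U) (h0 : ∀ z ∈ frontier Ω, p z = q z) :
    ∫ z in Ω, jac p z = ∫ z in Ω, jac q z := by
  have hp1 : ContDiffOn ℝ 1 p U := hp.of_le (by norm_num)
  have hq1 : ContDiffOn ℝ 1 q U := hq.of_le (by norm_num)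
  have hs : ContDiffOn ℝ 2 (fun z => p z + q z) U := hp.add hq
  have hs' : ContDiffOn ℝ 1 (fderiv ℝ (fun z => p z + q z)) U :=
    hs.fderiv_of_isOpen hU (by norm_num)
  set s' := fderiv ℝ (fun z => p z + q z) with hs'def
  have hF : ∀ v, ContDiffOn ℝ 1 (fun z => (starRingEnd ℂ (p z - q z) * s' z v).im) U := fun v =>
    imCLM.contDiff.comp_contDiffOn ((conjCLE.contDiff.comp_contDiffOn (hp1.sub hq1)).mul
      (hs'.clm_apply contDiffOn_const))
  have hz : ∀ v, ∀ z ∈ frontier Ω, (starRingEnd ℂ (p z - q z) * s' z v).im = 0 := by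
    intro v z hz; simp [h0 z hz]
  have e1 := green_real hΩo hΩb hΩf hU hUc (hF I) (hz I) 1
  have e2 := green_real hΩo hΩb hΩf hU hUc (hF 1) (hz 1) I
  have i1 := integrableOn_fderiv hΩb hUc (contOn_fderiv hU (hF I) 1)
  have i2 := integrableOn_fderiv hΩb hUc (contOn_fderiv hU (hF 1) I)
  have ip := integrableOn_fderiv hΩb hUc (contOn_jac hU hp1)
  have iq := integrableOn_fderiv hΩb hUc (contOn_jac hU hq1)
  suffices H : 2 * ∫ z in Ω, (jac p z - jac q z) = 0 by
    rw [integral_sub ip iq] at H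
    linarith
  have : (0 : ℝ) = ∫ z in Ω, (fderiv ℝ (fun z => (starRingEnd ℂ (p z - q z) * s' z I).im) z 1
      - fderiv ℝ (fun z => (starRingEnd ℂ (p z - q z) * s' z 1).im) z I) := by
    rw [integral_sub i1 i2, e1, e2]; simp
  rw [this, ← integral_const_mul]
  refine setIntegral_congr_fun hΩo.measurableSet fun z hz => ?_
  have hzU := hU.mem_nhds (hUc (subset_closure hz))
  have dp := ((hp1.contDiffAt hzU).differentiableAt (by simp)).hasFDerivAt
  have dq := ((hq1.contDiffAt hzU).differentiableAt (by simp)).hasFDerivAt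
  have dc : HasFDerivAt (fun z => starRingEnd ℂ (p z - q z)) _ z :=
    conjCLE.toContinuousLinearMap.hasFDerivAt.comp z (dp.sub dq)
  have ds := ((hs'.contDiffAt hzU).differentiableAt (by simp)).hasFDerivAt
  have dsv : ∀ v, HasFDerivAt (fun z => s' z v) _ z := fun v => ds.clm_apply (hasFDerivAt_const v z)
  have hsym : fderiv ℝ s' z 1 I = fderiv ℝ s' z I 1 :=
    (hs.contDiffAt hzU).isSymmSndFDerivAt (by simp) 1 I
  have hsz : s' z = fderiv ℝ p z + fderiv ℝ q z := (dp.add dq).fderiv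
  have dd : ∀ v, HasFDerivAt (fun z => (starRingEnd ℂ (p z - q z) * s' z v).im) _ z := fun v =>
    imCLM.hasFDerivAt.comp z (dc.mul (dsv v))
  simp only [jac]
  rw [(dd I).fderiv, (dd 1).fderiv]
  simp [hsym, hsz]
  ring

lemma norm_sq_dual (L : ℂ →L[ℝ] ℝ) : ‖L‖ ^ 2 = L 1 ^ 2 + L I ^ 2 := by
  have hL : ∀ v : ℂ, L v = v.re * L 1 + v.im * L I := by
    intro v
    conv_lhs => rw [show v = v.re • (1:ℂ) + v.im • I by simp [Complex.re_add_im]]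
    rw [map_add, map_smul, map_smul]; rfl
  have hn : ∀ v : ℂ, ‖v‖ ^ 2 = v.re ^ 2 + v.im ^ 2 := by
    intro v; rw [Complex.sq_norm, Complex.normSq_apply]; ring
  apply le_antisymm
  · have : ‖L‖ ≤ √(L 1 ^ 2 + L I ^ 2) := by
      refine L.opNorm_le_bound (Real.sqrt_nonneg _) fun v => ?_
      rw [Real.norm_eq_abs]
      refine abs_le_of_sq_le_sq ?_ (by positivity)
      rw [mul_pow, Real.sq_sqrt (by positivity), hn, hL]
      nlinarith [sq_nonneg (v.re * L I - v.im * L 1)]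
    calc ‖L‖ ^ 2 ≤ (√(L 1 ^ 2 + L I ^ 2)) ^ 2 := by gcongr
      _ = _ := Real.sq_sqrt (by positivity)
  · set v : ℂ := ⟨L 1, L I⟩ with hv
    have h1 : ‖v‖ ^ 2 = L 1 ^ 2 + L I ^ 2 := hn v
    have h2 : L v = ‖v‖ ^ 2 := by rw [h1, hL]; simp [hv]; ring
    have h3 := L.le_opNorm v
    rw [h2, Real.norm_of_nonneg (by positivity)] at h3
    rw [← h1]
    rcases eq_or_lt_of_le (norm_nonneg v) with h | h
    · rw [← h, zero_pow two_ne_zero]; positivity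
    · have : ‖v‖ ≤ ‖L‖ := by
        by_contra! hc; nlinarith
      gcongr

lemma energy_pt {u : ℂ → ℂ} {z : ℂ} (hu : DifferentiableAt ℝ u z) :
    ‖fderiv ℝ (fun w => (u w).re) z‖ ^ 2 + ‖fderiv ℝ (fun w => (u w).im) z‖ ^ 2
      = ‖wD u z‖ ^ 2 - 2 * jac u z := by
  have h1 : HasFDerivAt (fun w => (u w).re) _ z := reCLM.hasFDerivAt.comp z hu.hasFDerivAt
  have h2 : HasFDerivAt (fun w => (u w).im) _ z := imCLM.hasFDerivAt.comp z hu.hasFDerivAt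
  rw [norm_sq_dual, norm_sq_dual, h1.fderiv, h2.fderiv, Complex.sq_norm, Complex.normSq_apply]
  simp [wD, jac]
  ring

lemma wD_congr {p q : ℂ → ℂ} {z : ℂ} (h : p =ᶠ[nhds z] q) : wD p z = wD q z := by
  simp only [wD, h.fderiv_eq]

lemma jac_congr {p q : ℂ → ℂ} {z : ℂ} (h : p =ᶠ[nhds z] q) : jac p z = jac q z := by
  simp only [jac, h.fderiv_eq]

lemma harm {a b : ℂ → ℂ} {z a' b' : ℂ} (ha : HasDerivAt a a' z) (hb : HasDerivAt b b' z) :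
    wD (fun w => a w + starRingEnd ℂ (b w)) z = 2 * a' ∧
    jac (fun w => a w + starRingEnd ℂ (b w)) z = ‖a'‖ ^ 2 - ‖b'‖ ^ 2 := by
  have d : HasFDerivAt (fun w => a w + starRingEnd ℂ (b w)) _ z :=
    (ha.hasFDerivAt.restrictScalars ℝ).add
      (conjCLE.toContinuousLinearMap.hasFDerivAt.comp z (hb.hasFDerivAt.restrictScalars ℝ))
  constructor
  · simp only [wD]
    rw [d.fderiv]
    apply Complex.ext <;> simp <;> ring
  · simp only [jac]
    rw [d.fderiv]
    simp only [Complex.sq_norm, Complex.normSq_apply]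
    simp
    ring

lemma q_pt {z₀ z : ℂ} (hz : z ≠ z₀) {q : ℂ → ℂ}
    (hq : q =ᶠ[nhds z] fun w => 2 / (starRingEnd ℂ w - starRingEnd ℂ z₀)) :
    wD q z = 0 ∧ jac q z = - (4 / ‖z - z₀‖ ^ 4) := by
  have hne : z - z₀ ≠ 0 := sub_ne_zero.2 hz
  have hb : HasDerivAt (fun w : ℂ => 2 / (w - z₀)) (-2 / (z - z₀) ^ 2) z := by
    have : HasDerivAt (fun w : ℂ => 2 / (w - z₀)) _ z :=
      (hasDerivAt_const z (2:ℂ)).div ((hasDerivAt_id z).sub_const z₀) hne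
    convert this using 1
    simp
  have h := harm (hasDerivAt_const z (0:ℂ)) hb
  have e : q =ᶠ[nhds z] fun w => (0:ℂ) + starRingEnd ℂ (2 / (w - z₀)) := by
    filter_upwards [hq] with w hw
    simp [hw, Complex.conj_ofNat]
  rw [wD_congr e, jac_congr e, h.1, h.2]
  refine ⟨by simp, ?_⟩
  simp
  rw [div_pow, ← pow_mul]; norm_num

lemma exists_q (z₀ : ℂ) {r : ℝ} (hr : 0 < r) : ∃ q : ℂ → ℂ, ContDiff ℝ 2 q ∧
    ∀ z, r / 2 < dist z z₀ → q z = 2 / (starRingEnd ℂ z - starRingEnd ℂ z₀) := by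
  let χ : ContDiffBump z₀ := ⟨r / 4, r / 2, by positivity, by linarith⟩
  refine ⟨fun z => (1 - (χ z : ℂ)) * (2 / (starRingEnd ℂ z - starRingEnd ℂ z₀)), ?_, ?_⟩
  · rw [contDiff_iff_contDiffAt]
    intro z
    by_cases hz : z = z₀
    · refine (contDiffAt_const (c := (0:ℂ))).congr_of_eventuallyEq ?_
      rw [hz]
      filter_upwards [χ.eventuallyEq_one] with w hw
      simp [hw]
    · have h1 : ContDiff ℝ 2 (fun z => (1 - (χ z : ℂ))) :=
        contDiff_const.sub (ofRealCLM.contDiff.comp χ.contDiff)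
      have h2 : ContDiff ℝ 2 (fun z : ℂ => starRingEnd ℂ z - starRingEnd ℂ z₀) :=
        conjCLE.contDiff.sub contDiff_const
      have hne : starRingEnd ℂ z - starRingEnd ℂ z₀ ≠ 0 := by
        rw [← map_sub, map_ne_zero]; exact sub_ne_zero.2 hz
      simp only [div_eq_mul_inv]
      exact h1.contDiffAt.mul (contDiffAt_const.mul (h2.contDiffAt.inv hne))
  · intro z hz
    have : χ z = 0 := χ.zero_of_le_dist hz.le
    simp [this]

lemma q_ev {z₀ : ℂ} {r : ℝ} {q : ℂ → ℂ} 
    (hq : ∀ z, r / 2 < dist z z₀ → q z = 2 / (starRingEnd ℂ z - starRingEnd ℂ z₀))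
    {z : ℂ} (hz : r / 2 < dist z z₀) :
    q =ᶠ[nhds z] fun w => 2 / (starRingEnd ℂ w - starRingEnd ℂ z₀) := by
  have : IsOpen {w | r / 2 < dist w z₀} := isOpen_lt continuous_const (by fun_prop)
  filter_upwards [this.mem_nhds hz] with w hw using hq w hw

lemma frontier_ball_null (z₀ : ℂ) {r : ℝ} (hr : 0 < r) :
    volume (frontier (Metric.ball z₀ r)) = 0 := by
  rw [frontier_ball z₀ hr.ne']
  exact Measure.addHaar_sphere volume z₀ r

lemma q_sphere {z₀ : ℂ} {r : ℝ} (hr : 0 < r) {z : ℂ} (hz : z ∈ frontier (Metric.ball z₀ r)) :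
    2 / (starRingEnd ℂ z - starRingEnd ℂ z₀) = 2 / (r:ℂ) ^ 2 * (z - z₀) + starRingEnd ℂ 0 := by
  rw [frontier_ball z₀ hr.ne', mem_sphere_iff_norm] at hz
  have hne : z - z₀ ≠ 0 := by rw [← norm_pos_iff, hz]; exact hr
  have h : (z - z₀) * starRingEnd ℂ (z - z₀) = (r:ℂ) ^ 2 := by
    rw [Complex.mul_conj, Complex.normSq_eq_norm_sq, hz]; simp
  rw [← h, ← map_sub]
  have : starRingEnd ℂ (z - z₀) ≠ 0 := by
    rw [map_ne_zero]; exact hne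
  field_simp
  simp

lemma lin_pt (z₀ z c : ℂ) :
    wD (fun z => c * (z - z₀) + starRingEnd ℂ ((fun _ => 0 : ℂ → ℂ) z)) z = 2 * c ∧
    jac (fun z => c * (z - z₀) + starRingEnd ℂ ((fun _ => 0 : ℂ → ℂ) z)) z = ‖c‖ ^ 2 := by
  have ha : HasDerivAt (fun z => c * (z - z₀)) c z := by
    simpa using ((hasDerivAt_id z).sub_const z₀).const_mul c
  have := harm ha (hasDerivAt_const z (0:ℂ))
  simpa using this

lemma lin_smooth (z₀ c : ℂ) (n : WithTop ℕ∞) :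
    ContDiff ℝ n (fun z => c * (z - z₀) + starRingEnd ℂ ((fun _ => 0 : ℂ → ℂ) z)) := by
  simp only [map_zero, add_zero]
  exact contDiff_const.mul (contDiff_id.sub contDiff_const)

lemma vol_ball (z₀ : ℂ) {r : ℝ} (hr : 0 < r) :
    volume.real (Metric.ball z₀ r) = π * r ^ 2 := by
  rw [Measure.real, Complex.volume_ball]
  simp [hr.le]
  ring

lemma mean_value {z₀ : ℂ} {r : ℝ} (hr : 0 < r) {U : Set ℂ} (hU : IsOpen U)
    (hUc : closure (Metric.ball z₀ r) ⊆ U) {h : ℂ → ℂ} (hh : DifferentiableOn ℂ h U) :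
    ∫ z in Metric.ball z₀ r, h z = π * r ^ 2 * h z₀ := by
  have hz₀ : U ∈ nhds z₀ := hU.mem_nhds (hUc (subset_closure (Metric.mem_ball_self hr)))
  have hk := (Complex.differentiableOn_dslope hz₀).2 hh
  have hd : ∀ z, HasFDerivAt (fun z : ℂ => (z - z₀) * starRingEnd ℂ (z - z₀)) 
     ((z - z₀) • ((conjCLE : ℂ →L[ℝ] ℂ).comp (ContinuousLinearMap.id ℝ ℂ)) + 
       (starRingEnd ℂ (z - z₀)) • ContinuousLinearMap.id ℝ ℂ) z := by
    intro z
    have h1 : HasFDerivAt (fun z : ℂ => z - z₀) (ContinuousLinearMap.id ℝ ℂ) z :=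
      (hasFDerivAt_id z).sub_const z₀
    exact h1.mul ((conjCLE : ℂ →L[ℝ] ℂ).hasFDerivAt.comp z h1)
  have hM := lemma_M Metric.isOpen_ball Metric.isBounded_ball (frontier_ball_null z₀ hr) hU hUc hk
    (p := fun z => (z - z₀) * starRingEnd ℂ (z - z₀)) (q := fun _ => (r:ℂ) ^ 2)
    (by
      have h1 : ContDiff ℝ 1 (fun z : ℂ => z - z₀) := contDiff_id.sub contDiff_const
      exact (h1.mul (conjCLE.contDiff.comp h1)).contDiffOn) contDiffOn_const (by
      intro z hz
      rw [frontier_ball z₀ hr.ne', mem_sphere_iff_norm] at hz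
      rw [Complex.mul_conj, Complex.normSq_eq_norm_sq, hz]; simp)
  have hw : ∀ z, wD (fun z => (z - z₀) * starRingEnd ℂ (z - z₀)) z = 2 * starRingEnd ℂ (z - z₀) := by
    intro z
    simp only [wD]
    rw [(hd z).fderiv]
    simp
    ring_nf
    simp
    ring
  have hw0 : ∀ z, wD (fun _ => (r:ℂ) ^ 2) z = 0 := by intro z; simp [wD]
  simp only [hw, hw0, map_zero, mul_zero, integral_zero, map_mul, Complex.conj_conj] at hM
  have hint : IntegrableOn (fun z => dslope h z₀ z * (starRingEnd ℂ 2 * (z - z₀)))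
      (Metric.ball z₀ r) :=
    integrableOn_fderiv Metric.isBounded_ball hUc (hk.continuousOn.mul (by fun_prop))
  have e : ∀ z, h z = h z₀ + (1/2) * (dslope h z₀ z * (starRingEnd ℂ 2 * (z - z₀))) := by
    intro z
    have := sub_smul_dslope h z₀ z
    rw [smul_eq_mul] at this
    have h2 : starRingEnd ℂ (2:ℂ) = 2 := Complex.conj_ofNat 2
    rw [h2]
    linear_combination -this
  have hc : IntegrableOn (fun _ => h z₀) (Metric.ball z₀ r) :=
    integrableOn_const (by simp [Complex.volume_ball, ENNReal.mul_eq_top])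
  rw [integral_congr_ae (Filter.Eventually.of_forall e), integral_add hc (hint.const_mul _),
    integral_const_mul, hM, setIntegral_const, vol_ball z₀ hr]
  simp

lemma jac_q_integrable {z₀ : ℂ} {r : ℝ} (hr : 0 < r) {q : ℂ → ℂ} (hqc : ContDiff ℝ 2 q)
    (hq : ∀ z, r / 2 < dist z z₀ → q z = 2 / (starRingEnd ℂ z - starRingEnd ℂ z₀)) :
    Integrable (jac q) := by
  have hcont : Continuous (jac q) := by
    rw [← continuousOn_univ]
    exact contOn_jac isOpen_univ (hqc.of_le (by norm_num)).contDiffOn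
  have hI : Integrable (fun z : ℂ => (1 + ‖z - z₀‖) ^ (-(4:ℝ))) :=
    (integrable_one_add_norm (E := ℂ) (μ := volume) (r := 4)
      (by rw [Complex.finrank_real_complex]; norm_num)).comp_sub_right z₀
  refine hcont.locallyIntegrable.integrable_of_isBigO_cocompact ?_ (hI.integrableAtFilter _)
  refine Asymptotics.IsBigO.of_bound 64 ?_
  have hK : (Metric.closedBall z₀ (max r 1))ᶜ ∈ Filter.cocompact ℂ :=
    (isCompact_closedBall z₀ _).compl_mem_cocompact
  filter_upwards [hK] with z hz
  have hz' : max r 1 < dist z z₀ := by simpa using hz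
  have h1 : r < dist z z₀ := (le_max_left _ _).trans_lt hz'
  have h2 : 1 < ‖z - z₀‖ := by rw [← dist_eq_norm]; exact (le_max_right _ _).trans_lt hz'
  have hne : z ≠ z₀ := by rintro rfl; simp at h1; linarith
  rw [(q_pt hne (q_ev hq (by linarith))).2, norm_neg, Real.norm_of_nonneg (by positivity),
    Real.norm_of_nonneg (by positivity), Real.rpow_neg (by positivity),
    show (4:ℝ) = ((4:ℕ):ℝ) by norm_num, Real.rpow_natCast, ← div_eq_mul_inv]
  rw [div_le_div_iff₀ (by positivity) (by positivity)]
  have : (1 + ‖z - z₀‖) ^ 4 ≤ (2 * ‖z - z₀‖) ^ 4 := by gcongr; linarith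
  rw [mul_pow] at this
  push_cast
  nlinarith

lemma jac_q_integral {z₀ : ℂ} {r : ℝ} (hr : 0 < r) {q : ℂ → ℂ} (hqc : ContDiff ℝ 2 q)
    (hq : ∀ z, r / 2 < dist z z₀ → q z = 2 / (starRingEnd ℂ z - starRingEnd ℂ z₀)) :
    ∫ z, jac q z = 0 := by
  have hi := jac_q_integrable hr hqc hq
  have ht := (aecover_ball (μ := (volume : Measure ℂ)) (x := z₀) (l := Filter.atTop)
    (r := fun R : ℝ => R) Filter.tendsto_id).integral_tendsto_of_countably_generated hi
  have ht2 : Filter.Tendsto (fun R : ℝ => 4 * π / R ^ 2) Filter.atTop (nhds 0) :=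
    Filter.Tendsto.const_div_atTop (Filter.tendsto_pow_atTop (by norm_num)) _
  refine tendsto_nhds_unique ht (ht2.congr' ?_)
  filter_upwards [Filter.eventually_gt_atTop r] with R hR
  have hR0 : 0 < R := hr.trans hR
  have hN := lemma_N Metric.isOpen_ball Metric.isBounded_ball (frontier_ball_null z₀ hR0)
    isOpen_univ (Set.subset_univ _) hqc.contDiffOn
    (lin_smooth z₀ (2 / (R:ℂ)^2) 2).contDiffOn (by
      intro z hz
      rw [← q_sphere hR0 hz]
      rw [frontier_ball z₀ hR0.ne', mem_sphere_iff_norm, ← dist_eq_norm] at hz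
      exact hq z (by linarith))
  rw [hN]
  simp only [(lin_pt z₀ _ _).2]
  rw [setIntegral_const, vol_ball z₀ hR0]
  simp
  field_simp
  norm_num

/-- representation of the renormalized tail energy. If `Ω ⊂ ℂ` is a
bounded open set whose boundary is a positively oriented injective `C¹` closed curve
with nonvanishing derivative, `z₀ ∈ Ω`, `f, g` are holomorphic near the closure of
`Ω`, and the continuous map `u` equals `f + conj ∘ g` on the closure of `Ω` and
`2/(conj z − conj z₀)` outside `Ω`, then `D(u) = 8π f′(z₀)`; in particular `f′(z₀)`
is a nonnegative real number. -/
theorem tail_energy_representation (Ω : Set ℂ) (hΩo : IsOpen Ω)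
    (hΩb : Bornology.IsBounded Ω)
    (γ : ℝ → ℂ) (hper : ∀ t, γ (t + 2 * π) = γ t) (hC1 : ContDiff ℝ 1 γ)
    (hder : ∀ t, deriv γ t ≠ 0) (hinj : Set.InjOn γ (Set.Ico 0 (2 * π)))
    (himg : γ '' Set.Ico 0 (2 * π) = frontier Ω)
    (horient : ∀ w ∈ Ω,
      (1 / (2 * (π : ℂ) * Complex.I)) * ∫ t in (0 : ℝ)..(2 * π), deriv γ t / (γ t - w) = 1)
    (z₀ : ℂ) (hz₀ : z₀ ∈ Ω) (f g u : ℂ → ℂ)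
    (U : Set ℂ) (hU : IsOpen U) (hUc : closure Ω ⊆ U)
    (hf : DifferentiableOn ℂ f U) (hg : DifferentiableOn ℂ g U)
    (hu : Continuous u)
    (hu1 : ∀ z ∈ closure Ω, u z = f z + starRingEnd ℂ (g z))
    (hu2 : ∀ z ∉ Ω, u z = 2 / (starRingEnd ℂ z - starRingEnd ℂ z₀)) :
    (dirE u : ℂ) = 8 * (π : ℂ) * deriv f z₀ := by
  have hf0 : volume (frontier Ω) = 0 := by rw [← himg]; exact null_curve γ hC1 _
  obtain ⟨r, hr, hrΩ⟩ := Metric.nhds_basis_closedBall.mem_iff.1 (hΩo.mem_nhds hz₀)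
  obtain ⟨q, hqc, hq⟩ := exists_q z₀ hr
  have hqc1 : ContDiff ℝ 1 q := hqc.of_le (by norm_num)
  have hfar : ∀ z ∉ Ω, r < dist z z₀ := by
    intro z hz
    by_contra! hc
    exact hz (hrΩ hc)
  have hf' : DifferentiableOn ℂ (deriv f) U := hf.deriv hU
  set p : ℂ → ℂ := fun w => f w + starRingEnd ℂ (g w) with hp
  have hpc : ∀ n, ContDiffOn ℝ n p U := fun n =>
    (holo_real hU hf).add (conjCLE.contDiff.comp_contDiffOn (holo_real hU hg))
  have hpq : ∀ z ∈ frontier Ω, p z = q z := by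
    intro z hz
    have hzΩ : z ∉ Ω := by rw [hΩo.frontier_eq] at hz; exact hz.2
    have hd := hfar z hzΩ
    rw [hq z (by linarith), ← hu2 z hzΩ, hu1 z (frontier_subset_closure hz)]
  have hpw : ∀ z ∈ Ω, wD p z = 2 * deriv f z := by
    intro z hz
    have hzU := hU.mem_nhds (hUc (subset_closure hz))
    exact (harm (hf.differentiableAt hzU).hasDerivAt (hg.differentiableAt hzU).hasDerivAt).1
  -- the Jacobian part
  have hJq := jac_q_integrable hr hqc hq
  have hJp : IntegrableOn (jac p) Ω := integrableOn_fderiv hΩb hUc (contOn_jac hU (hpc 1))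
  have hJ : (∫ z in Ω, jac p z) + ∫ z in Ωᶜ, jac q z = 0 := by
    rw [lemma_N hΩo hΩb hf0 hU hUc (hpc 2) hqc.contDiffOn hpq,
      integral_add_compl hΩo.measurableSet hJq, jac_q_integral hr hqc hq]
  have hW : IntegrableOn (fun z => ‖wD p z‖ ^ 2) Ω :=
    integrableOn_fderiv hΩb hUc ((contOn_wD hU (hpc 1)).norm.pow 2)
  have hae : ∀ᵐ z : ℂ, z ∉ frontier Ω := by
    rw [ae_iff]; simpa using hf0
  have hE : dirE u = ∫ z in Ω, ‖wD p z‖ ^ 2 := by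
    have h1 : dirE u = ∫ z, (Ω.indicator (fun z => ‖wD p z‖ ^ 2) z -
        2 * (Ω.indicator (jac p) z + Ωᶜ.indicator (jac q) z)) := by
      refine integral_congr_ae ?_
      filter_upwards [hae] with z hz
      by_cases hzΩ : z ∈ Ω
      · have e : u =ᶠ[nhds z] p := by
          filter_upwards [hΩo.mem_nhds hzΩ] with y hy using hu1 y (subset_closure hy)
        have hd : DifferentiableAt ℝ u z :=
          (((hpc 1).contDiffAt (hU.mem_nhds (hUc (subset_closure hzΩ)))).differentiableAt
            (by simp)).congr_of_eventuallyEq e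
        rw [energy_pt hd, wD_congr e, jac_congr e]
        simp [hzΩ]
      · have hzc : z ∈ (closure Ω)ᶜ := fun hc => hz ⟨hc, by rwa [hΩo.interior_eq]⟩
        have hdz := hfar z hzΩ
        have e : u =ᶠ[nhds z] q := by
          filter_upwards [isClosed_closure.isOpen_compl.mem_nhds hzc] with y hy
          have hyΩ : y ∉ Ω := fun h => hy (subset_closure h)
          have hdy := hfar y hyΩ
          rw [hu2 y hyΩ, hq y (by linarith)]
        have hd : DifferentiableAt ℝ u z :=
          (hqc1.differentiable (by simp) z).congr_of_eventuallyEq e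
        have hne : z ≠ z₀ := by rintro rfl; exact hzΩ hz₀
        rw [energy_pt hd, wD_congr e, jac_congr e, (q_pt hne (q_ev hq (by linarith))).1]
        simp [hzΩ]
    rw [h1, integral_sub, integral_const_mul, integral_add, integral_indicator hΩo.measurableSet,
      integral_indicator hΩo.measurableSet, integral_indicator hΩo.measurableSet.compl, hJ]
    · simp
    · exact hJp.integrable_indicator hΩo.measurableSet
    · exact hJq.integrableOn.integrable_indicator hΩo.measurableSet.compl
    · exact hW.integrable_indicator hΩo.measurableSet
    · exact ((hJp.integrable_indicator hΩo.measurableSet).add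
        (hJq.integrableOn.integrable_indicator hΩo.measurableSet.compl)).const_mul 2
  -- the holomorphic part
  have hM1 := lemma_M hΩo hΩb hf0 hU hUc hf' (hpc 1) hqc1.contDiffOn hpq
  have hBΩ : Metric.ball z₀ r ⊆ Ω := Metric.ball_subset_closedBall.trans hrΩ
  have hBU : closure (Metric.ball z₀ r) ⊆ U := (closure_mono hBΩ).trans hUc
  have hM2 := lemma_M Metric.isOpen_ball Metric.isBounded_ball (frontier_ball_null z₀ hr) hU hBU hf'
    hqc1.contDiffOn (lin_smooth z₀ (2 / (r:ℂ)^2) 1).contDiffOn (by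
      intro z hz
      rw [← q_sphere hr hz]
      rw [frontier_ball z₀ hr.ne', mem_sphere_iff_norm, ← dist_eq_norm] at hz
      exact hq z (by linarith))
  have hM3 : ∫ z in Ω, deriv f z * starRingEnd ℂ (wD q z) =
      ∫ z in Metric.ball z₀ r, deriv f z * starRingEnd ℂ (wD q z) := by
    refine (setIntegral_eq_of_subset_of_forall_sdiff_eq_zero hΩo.measurableSet hBΩ ?_)
    intro z hz
    have hd : r ≤ dist z z₀ := by simpa using hz.2
    have hne : z ≠ z₀ := by rintro rfl; simp at hd; linarith
    rw [(q_pt hne (q_ev hq (by linarith))).1]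
    simp
  simp only [(lin_pt z₀ _ _).1] at hM2
  rw [integral_mul_const, mean_value hr hU hBU hf'] at hM2
  have hA : (∫ z in Ω, ((‖wD p z‖ ^ 2 : ℝ) : ℂ)) =
      2 * ∫ z in Ω, deriv f z * starRingEnd ℂ (wD p z) := by
    rw [← integral_const_mul]
    refine setIntegral_congr_fun hΩo.measurableSet fun z hz => ?_
    rw [← Complex.normSq_eq_norm_sq, ← Complex.mul_conj]
    conv_lhs => rw [hpw z hz]
    rw [hpw z hz]
    ring
  rw [hE, ← integral_complex_ofReal, hA, hM1, hM3, hM2]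
  have hr' : (r:ℂ) ≠ 0 := by exact_mod_cast hr.ne'
  simp [Complex.conj_ofNat]
  field_simp
  ring

end
end
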